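/- Let X be a compact Ptolemy space with properties (E) and (I). Then X has the extension property (E₂): for any Ptolemy circles σ, σ' ⊆ X, every bijection ψ : σ → σ' that preserves cross-ratio triples extends to a Möbius automorphism of X. -/

import Mathlib

open scoped ENNReal

namespace Mobius

/-- An extended metric on `X`, allowed to have (at most) one infinitely remote point,
which is recorded in the field `rem`.  Distances take values in `ℝ≥0∞`, and the value `⊤`
occurs exactly on pairs of distinct points one of which is the remote point. -/
structure ExtMetric (X : Type*) where
  d : X → X → ℝ≥0∞
  rem : Option X
  symm : ∀ x y, d x y = d y x
  d_self : ∀ x, d x x = 0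
  pos : ∀ x y, x ≠ y → 0 < d x y
  triangle : ∀ x y z, d x z ≤ d x y + d y z
  d_eq_top_iff : ∀ x y, d x y = ⊤ ↔ (x ≠ y ∧ (rem = some x ∨ rem = some y))

/-- The finite factor of a distance used in cross-ratio triples: infinite factors are
dropped (replaced by `1`), in accordance with the standard conventions for cross-ratio
triples of quadruples containing the infinitely remote point. -/
noncomputable def ExtMetric.fd {X : Type*} (d : ExtMetric X) (x y : X) : ℝ :=
  if d.d x y = ⊤ then 1 else (d.d x y).toReal

/-- A representative in `ℝ³` of the cross-ratio triple
`crt(x,y,z,u) = (d(x,y)d(z,u) : d(x,z)d(y,u) : d(x,u)d(y,z)) ∈ ℝP²`,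
with the standard conventions when the infinitely remote point occurs among the points. -/
noncomputable def crtVec {X : Type*} (d : ExtMetric X) (x y z u : X) : ℝ × ℝ × ℝ :=
  (d.fd x y * d.fd z u, d.fd x z * d.fd y u, d.fd x u * d.fd y z)

/-- A quadruple is admissible if no entry occurs three or four times in it. -/
def Admissible {X : Type*} (x y z u : X) : Prop :=
  ¬(x = y ∧ y = z) ∧ ¬(x = y ∧ y = u) ∧ ¬(x = z ∧ z = u) ∧ ¬(y = z ∧ z = u)

/-- Two vectors in `ℝ³` represent the same point of the projective plane (they are
positively proportional). -/
def ProjEq (v w : ℝ × ℝ × ℝ) : Prop :=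
  ∃ lam : ℝ, 0 < lam ∧ w = lam • v

theorem ProjEq.refl (v : ℝ × ℝ × ℝ) : ProjEq v v :=
  ⟨1, one_pos, (one_smul ℝ v).symm⟩

theorem ProjEq.symm {v w : ℝ × ℝ × ℝ} (h : ProjEq v w) : ProjEq w v := by
  obtain ⟨l, hl, rfl⟩ := h
  exact ⟨l⁻¹, inv_pos.mpr hl, by rw [smul_smul, inv_mul_cancel₀ hl.ne', one_smul]⟩

theorem ProjEq.trans' {v w u : ℝ × ℝ × ℝ} (h1 : ProjEq v w) (h2 : ProjEq v u) :
    ProjEq w u := by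
  obtain ⟨l, hl, rfl⟩ := h1
  obtain ⟨m, hm, rfl⟩ := h2
  refine ⟨m * l⁻¹, by positivity, ?_⟩
  rw [smul_smul, mul_assoc, inv_mul_cancel₀ hl.ne', mul_one]

/-- A Möbius structure on a set `X`: a (maximal) class of pairwise Möbius-equivalent
extended metrics on `X`, i.e. metrics defining the same cross-ratio triples on all
admissible quadruples. -/
structure MobiusStructure (X : Type*) where
  M : Set (ExtMetric X)
  nonempty : M.Nonempty
  compat : ∀ d ∈ M, ∀ d' ∈ M, ∀ x y z u : X, Admissible x y z u →
    ProjEq (crtVec d x y z u) (crtVec d' x y z u)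
  maximal : ∀ d' : ExtMetric X,
    (∀ d ∈ M, ∀ x y z u : X, Admissible x y z u →
      ProjEq (crtVec d x y z u) (crtVec d' x y z u)) → d' ∈ M

/-- The Möbius structure generated by a single extended metric. -/
def MobiusStructure.ofMetric {X : Type*} (d₀ : ExtMetric X) : MobiusStructure X where
  M := {d | ∀ x y z u : X, Admissible x y z u →
    ProjEq (crtVec d₀ x y z u) (crtVec d x y z u)}
  nonempty := ⟨d₀, fun _ _ _ _ _ => ProjEq.refl _⟩
  compat := fun _ hd _ hd' x y z u ha => (hd x y z u ha).trans' (hd' x y z u ha)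
  maximal := fun _ h => h d₀ (fun _ _ _ _ _ => ProjEq.refl _)

/-- A Möbius structure is Ptolemy if the entries of every cross-ratio triple of every
admissible quadruple satisfy the triangle inequality. -/
def IsPtolemyStructure {X : Type*} (S : MobiusStructure X) : Prop :=
  ∀ d ∈ S.M, ∀ x y z u : X, Admissible x y z u →
    (crtVec d x y z u).1 ≤ (crtVec d x y z u).2.1 + (crtVec d x y z u).2.2 ∧
    (crtVec d x y z u).2.1 ≤ (crtVec d x y z u).1 + (crtVec d x y z u).2.2 ∧
    (crtVec d x y z u).2.2 ≤ (crtVec d x y z u).1 + (crtVec d x y z u).2.1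

/-- The topology of a Möbius space: generated by the open balls of the metrics of the
structure (centered at points distinct from the respective remote points) together with
the complements of the closed balls. -/
def mobiusTop {X : Type*} (S : MobiusStructure X) : TopologicalSpace X :=
  TopologicalSpace.generateFrom
    {s | ∃ d ∈ S.M, ∃ x : X, d.rem ≠ some x ∧ ∃ r : ℝ≥0∞, 0 < r ∧ r ≠ ⊤ ∧
      (s = {y | d.d y x < r} ∨ s = {y | r < d.d y x})}

/-- Connected components of subsets with respect to the Möbius topology. -/
def mobiusCCIn {X : Type*} (S : MobiusStructure X) (F : Set X) (x : X) : Set X :=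
  @connectedComponentIn X (mobiusTop S) F x

/-- The pair `(x,z)` separates the pair `(y,u)` in `σ`:  `y` and `u` lie in different
connected components of `σ \ {x,z}`. -/
def SeparatesIn {X : Type*} (S : MobiusStructure X) (σ : Set X) (x z y u : X) : Prop :=
  u ∉ mobiusCCIn S (σ \ {x, z}) y

/-- `σ` is homeomorphic to the circle `S¹` (with respect to the Möbius topology). -/
def HomeoToCircle {X : Type*} (S : MobiusStructure X) (σ : Set X) : Prop :=
  letI : TopologicalSpace X := mobiusTop S
  Nonempty (σ ≃ₜ Metric.sphere (0 : ℂ) 1)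

/-- `X` is homeomorphic to the sphere `Sⁿ ⊆ ℝ^{n+1}` (w.r.t. the Möbius topology). -/
def HomeoToSphere {X : Type*} (S : MobiusStructure X) (n : ℕ) : Prop :=
  letI : TopologicalSpace X := mobiusTop S
  Nonempty (X ≃ₜ Metric.sphere (0 : EuclideanSpace ℝ (Fin (n + 1))) 1)

/-- The subset `A ⊆ X` is homeomorphic to `ℝᵖ` (w.r.t. the Möbius topology). -/
def SubsetHomeoToEuclidean {X : Type*} (S : MobiusStructure X) (A : Set X) (p : ℕ) : Prop :=
  letI : TopologicalSpace X := mobiusTop S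
  Nonempty (A ≃ₜ EuclideanSpace ℝ (Fin p))

/-- The subset `A ⊆ X` is homeomorphic to `ℝ` (w.r.t. the Möbius topology). -/
def SubsetHomeoToReal {X : Type*} (S : MobiusStructure X) (A : Set X) : Prop :=
  letI : TopologicalSpace X := mobiusTop S
  Nonempty (A ≃ₜ ℝ)

/-- A Ptolemy circle: a subset homeomorphic to `S¹` on which the Ptolemy equality holds
for every quadruple of distinct points `(x,y,z,u)` such that `(x,z)` separates `(y,u)`. -/
def IsPtolemyCircle {X : Type*} (S : MobiusStructure X) (σ : Set X) : Prop :=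
  HomeoToCircle S σ ∧
  ∀ d ∈ S.M, ∀ x ∈ σ, ∀ y ∈ σ, ∀ z ∈ σ, ∀ u ∈ σ,
    x ≠ y → x ≠ z → x ≠ u → y ≠ z → y ≠ u → z ≠ u →
    SeparatesIn S σ x z y u →
    d.d x z * d.d y u = d.d x y * d.d z u + d.d x u * d.d y z

/-- A Möbius automorphism of `X`: a bijection preserving all cross-ratio triples. -/
def IsMobiusAuto {X : Type*} (S : MobiusStructure X) (f : X → X) : Prop :=
  Function.Bijective f ∧ ∀ d ∈ S.M, ∀ x y z u : X, Admissible x y z u →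
    ProjEq (crtVec d x y z u) (crtVec d (f x) (f y) (f z) (f u))

/-- A metric sphere between two distinct points `ω`, `ω'`. -/
def IsMetricSphere {X : Type*} (S : MobiusStructure X) (ω ω' : X) (Sp : Set X) : Prop :=
  ∃ d ∈ S.M, d.rem = some ω' ∧ ∃ r : ℝ≥0∞, 0 < r ∧ r ≠ ⊤ ∧ Sp = {x | d.d x ω = r}

/-- A space inversion with respect to `ω`, `ω'` and a metric sphere `Sp` between them. -/
def IsSpaceInversion {X : Type*} (S : MobiusStructure X) (ω ω' : X) (Sp : Set X)
    (φ : X → X) : Prop :=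
  IsMobiusAuto S φ ∧ Function.Involutive φ ∧ (∀ x, φ x ≠ x) ∧ φ ω = ω' ∧
  φ '' Sp = Sp ∧ ∀ σ : Set X, IsPtolemyCircle S σ → ω ∈ σ → ω' ∈ σ → φ '' σ = σ

/-- Property (E): existence of at least one Ptolemy circle. -/
def PropertyE {X : Type*} (S : MobiusStructure X) : Prop :=
  ∃ σ : Set X, IsPtolemyCircle S σ

/-- Property (I): existence and uniqueness of space inversions. -/
def PropertyI {X : Type*} (S : MobiusStructure X) : Prop :=
  ∀ ω ω' : X, ω ≠ ω' → ∀ Sp : Set X, IsMetricSphere S ω ω' Sp →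
    ∃! φ : X → X, IsSpaceInversion S ω ω' Sp φ

/-- The Möbius space is compact. -/
def MobiusCompact {X : Type*} (S : MobiusStructure X) : Prop :=
  letI : TopologicalSpace X := mobiusTop S
  CompactSpace X

/-- Property (H), the homothety property. -/
def PropertyH {X : Type*} (S : MobiusStructure X) : Prop :=
  ∀ ω ω' : X, ω ≠ ω' → ∀ σ : Set X, IsPtolemyCircle S σ → ω ∈ σ → ω' ∈ σ →
    ∀ x x' : X, x ∈ σ \ {ω, ω'} → x' ∈ mobiusCCIn S (σ \ {ω, ω'}) x →
    ∃ γ : X → X, IsMobiusAuto S γ ∧ γ ω = ω ∧ γ ω' = ω' ∧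
      (∀ σ' : Set X, IsPtolemyCircle S σ' → ω ∈ σ' → ω' ∈ σ' →
        γ '' σ' = σ' ∧ ∀ y ∈ σ' \ {ω, ω'}, γ y ∈ mobiusCCIn S (σ' \ {ω, ω'}) y) ∧
      γ x = x'

/-- A Ptolemy line in `X_ω`: a Ptolemy circle through `ω` with `ω` removed. -/
def IsPtolemyLine {X : Type*} (S : MobiusStructure X) (ω : X) (l : Set X) : Prop :=
  ∃ σ : Set X, IsPtolemyCircle S σ ∧ ω ∈ σ ∧ l = σ \ {ω}

/-- `c : ℝ → X` is a unit-speed parameterization of `l ⊆ X` w.r.t. the metric `d`. -/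
def IsUnitSpeed {X : Type*} (d : ExtMetric X) (l : Set X) (c : ℝ → X) : Prop :=
  Set.range c = l ∧ ∀ s t : ℝ, d.d (c s) (c t) = ENNReal.ofReal |s - t|

/-- `b` is a Busemann function of the Ptolemy line `l ⊆ X_ω`:  up to an additive constant,
`b x = lim_{t→∞} (d(x,c(t)) − t)` for a unit-speed parameterization `c` of `l`. -/
def IsBusemannOf {X : Type*} (S : MobiusStructure X) (d : ExtMetric X) (ω : X)
    (l : Set X) (b : X → ℝ) : Prop :=
  IsPtolemyLine S ω l ∧ ∃ c : ℝ → X, IsUnitSpeed d l c ∧ ∃ C : ℝ, ∀ x : X, x ≠ ω →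
    Filter.Tendsto (fun t => (d.d x (c t)).toReal - t) Filter.atTop (nhds (b x + C))

/-- The fiber through `x` of the canonical fibration `π_ω`: the set of points on which
every Busemann function of every Ptolemy line of `X_ω` takes the same value as at `x`. -/
def mobiusFiber {X : Type*} (S : MobiusStructure X) (d : ExtMetric X) (ω : X) (x : X) :
    Set X :=
  {y | y ≠ ω ∧ ∀ (l : Set X) (b : X → ℝ), IsBusemannOf S d ω l b → b y = b x}

/-- The base `B_ω` of the canonical fibration: the set of all fibers. -/
def mobiusBase {X : Type*} (S : MobiusStructure X) (d : ExtMetric X) (ω : X) :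
    Set (Set X) :=
  {F | ∃ x : X, x ≠ ω ∧ F = mobiusFiber S d ω x}

/-- The distance between two fibers. -/
noncomputable def fiberDist {X : Type*} (d : ExtMetric X) (F F' : Set X) : ℝ :=
  sInf {r : ℝ | ∃ x ∈ F, ∃ x' ∈ F', r = (d.d x x').toReal}

/-- Two Möbius spaces are Möbius equivalent: there is a bijection between them
preserving all cross-ratio triples. -/
def MobiusEquiv {X Y : Type*} (S : MobiusStructure X) (S' : MobiusStructure Y) : Prop :=
  ∃ f : X → Y, Function.Bijective f ∧ ∀ d ∈ S.M, ∀ d' ∈ S'.M, ∀ x y z u : X,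
    Admissible x y z u → ProjEq (crtVec d x y z u) (crtVec d' (f x) (f y) (f z) (f u))

/-- The standard extended Euclidean metric on the one-point extension
`ℝ̂ⁿ = ℝⁿ ∪ {∞}`, where `∞` is encoded by `none`. -/
noncomputable def stdExtMetric (n : ℕ) : ExtMetric (Option (EuclideanSpace ℝ (Fin n))) where
  d x y :=
    match x, y with
    | none, none => 0
    | none, some _ => ⊤
    | some _, none => ⊤
    | some a, some b => ENNReal.ofReal (dist a b)
  rem := some none
  symm := by intro x y; cases x <;> cases y <;> simp [dist_comm]
  d_self := by intro x; cases x <;> simp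
  pos := by
    intro x y h
    cases x <;> cases y
    · exact absurd rfl h
    · simp
    · simp
    · simp only [ne_eq, Option.some.injEq] at h
      exact ENNReal.ofReal_pos.mpr (dist_pos.mpr h)
  triangle := by
    intro x y z
    cases x <;> cases y <;> cases z <;>
      simp only [le_refl, le_top, zero_le, zero_add, add_zero, top_add, add_top,
        top_le_iff]
    rw [← ENNReal.ofReal_add dist_nonneg dist_nonneg]
    exact ENNReal.ofReal_le_ofReal (dist_triangle _ _ _)
  d_eq_top_iff := by
    intro x y
    cases x <;> cases y <;>
      simp [ENNReal.ofReal_ne_top]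

section
open Filter Topology Set
variable {X : Type*} [MetricSpace X]

/-- The Ptolemy inequality. -/
def PtolemyIneq (X : Type*) [MetricSpace X] : Prop :=
  ∀ x y z u : X, dist x z * dist y u ≤ dist x y * dist z u + dist x u * dist y z

/-- The metric inversion of `dist` with remote point `ω`. -/
noncomputable def rd (ω x y : X) : ℝ := dist x y / (dist x ω * dist y ω)

theorem rd_comm (ω x y : X) : rd ω x y = rd ω y x := by
  unfold rd; rw [dist_comm x y, mul_comm]

theorem rd_self (ω x : X) : rd ω x x = 0 := by simp [rd]

theorem rd_nonneg (ω x y : X) : 0 ≤ rd ω x y := by unfold rd; positivity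

theorem rd_pos {ω x y : X} (hx : x ≠ ω) (hy : y ≠ ω) (hxy : x ≠ y) : 0 < rd ω x y := by
  have := dist_pos.2 hx; have := dist_pos.2 hy; have := dist_pos.2 hxy
  unfold rd; positivity

theorem dist_eq_rd_mul {ω x y : X} (hx : x ≠ ω) (hy : y ≠ ω) :
    dist x y = rd ω x y * (dist x ω * dist y ω) := by
  have := (dist_pos.2 hx).ne'; have := (dist_pos.2 hy).ne'
  unfold rd; field_simp

theorem eq_of_rd_eq_zero {ω x y : X} (hx : x ≠ ω) (hy : y ≠ ω) (h : rd ω x y = 0) : x = y := by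
  by_contra hxy
  exact (rd_pos hx hy hxy).ne' h

theorem rd_ptolemy (hpt : PtolemyIneq X) {ω x y z u : X} (hx : x ≠ ω) (hy : y ≠ ω) (hz : z ≠ ω)
    (hu : u ≠ ω) :
    rd ω x z * rd ω y u ≤ rd ω x y * rd ω z u + rd ω x u * rd ω y z := by
  have h := hpt x y z u
  have h1 := dist_pos.2 hx; have h2 := dist_pos.2 hy; have h3 := dist_pos.2 hz
  have h4 := dist_pos.2 hu
  have e1 : rd ω x z * rd ω y u =
      dist x z * dist y u / (dist x ω * dist y ω * dist z ω * dist u ω) := by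
    unfold rd; field_simp
  have e2 : rd ω x y * rd ω z u + rd ω x u * rd ω y z =
      (dist x y * dist z u + dist x u * dist y z) /
        (dist x ω * dist y ω * dist z ω * dist u ω) := by
    unfold rd; field_simp
  rw [e1, e2]
  gcongr

theorem rd_triangle (hpt : PtolemyIneq X) {ω x y z : X} (hx : x ≠ ω) (hy : y ≠ ω) (hz : z ≠ ω) :
    rd ω x z ≤ rd ω x y + rd ω y z := by
  have h := hpt x y z ω
  have h1 := dist_pos.2 hx; have h2 := dist_pos.2 hy; have h3 := dist_pos.2 hz
  have e1 : rd ω x z = dist x z * dist y ω / (dist x ω * dist y ω * dist z ω) := by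
    unfold rd; field_simp
  have e2 : rd ω x y + rd ω y z = (dist x y * dist z ω + dist x ω * dist y z) /
        (dist x ω * dist y ω * dist z ω) := by
    unfold rd; field_simp
  rw [e1, e2]
  gcongr

theorem tendsto_rd {ι : Type*} {l : Filter ι} {f g : ι → X} {ω x y : X}
    (hf : Tendsto f l (𝓝 x)) (hg : Tendsto g l (𝓝 y)) (hx : x ≠ ω) (hy : y ≠ ω) :
    Tendsto (fun i => rd ω (f i) (g i)) l (𝓝 (rd ω x y)) := by
  unfold rd
  refine (hf.dist hg).div ((hf.dist tendsto_const_nhds).mul (hg.dist tendsto_const_nhds)) ?_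
  have := (dist_pos.2 hx).ne'; have := (dist_pos.2 hy).ne'
  positivity

theorem rd_inv {ω o x y : X} (hx : x ≠ ω) (hy : y ≠ ω) (ho : o ≠ ω) :
    rd o x y = (dist o ω ^ 2)⁻¹ * (rd ω x y / (rd ω x o * rd ω y o)) := by
  rcases eq_or_ne x o with rfl | hxo
  · simp [rd]
  rcases eq_or_ne y o with rfl | hyo
  · simp [rd]
  have h1 := dist_pos.2 hx; have h2 := dist_pos.2 hy; have h3 := dist_pos.2 ho
  have h4 := dist_pos.2 hxo; have h5 := dist_pos.2 hyo
  unfold rd; field_simp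

theorem rd_inv_remote {ω o x : X} (hx : x ≠ ω) (hxo : x ≠ o) (ho : o ≠ ω) :
    rd o x ω = (dist o ω ^ 2)⁻¹ / rd ω x o := by
  have h1 := dist_pos.2 hx; have h3 := dist_pos.2 ho
  have h4 := dist_pos.2 hxo
  unfold rd; rw [dist_comm ω o]; field_simp

/-- A surjective self-map multiplying distances by a conformal factor. -/
def IsConf (f : X → X) : Prop :=
  Function.Surjective f ∧ ∃ m : X → ℝ, (∀ x, 0 < m x) ∧
    ∀ x y, dist (f x) (f y) = m x * m y * dist x y

theorem IsConf.injective {f : X → X} (hf : IsConf f) : Function.Injective f := by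
  obtain ⟨-, m, hm, h⟩ := hf
  intro x y hxy
  have h1 := h x y
  rw [hxy, dist_self] at h1
  have := hm x; have := hm y
  by_contra hne
  have := dist_pos.2 hne
  have : 0 < m x * m y * dist x y := by positivity
  linarith

theorem IsConf.comp {f g : X → X} (hf : IsConf f) (hg : IsConf g) : IsConf (fun x => f (g x)) := by
  obtain ⟨h1, m, hm, h2⟩ := hf
  obtain ⟨h1', m', hm', h2'⟩ := hg
  refine ⟨h1.comp h1', fun x => m (g x) * m' x, fun x => mul_pos (hm _) (hm' _), fun x y => ?_⟩
  rw [h2, h2']; ring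

theorem isConf_id : IsConf (fun x : X => x) :=
  ⟨Function.surjective_id, fun _ => 1, fun _ => one_pos, fun x y => by simp⟩

theorem IsConf.exists_factor {f : X → X} (hf : IsConf f) (ω : X) :
    ∃ κ : ℝ, 0 < κ ∧ ∀ x y, rd (f ω) (f x) (f y) = κ * rd ω x y := by
  obtain ⟨-, m, hm, h⟩ := hf
  refine ⟨(m ω ^ 2)⁻¹, by have := hm ω; positivity, fun x y => ?_⟩
  have h1 := (hm ω).ne'; have h2 := (hm x).ne'; have h3 := (hm y).ne'
  unfold rd
  rw [h, h, h]
  field_simp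

/-- `c` is a unit speed line in the space with remote point `ω`. -/
def IsLine (ω : X) (c : ℝ → X) : Prop :=
  (∀ t, c t ≠ ω) ∧ ∀ t u, rd ω (c t) (c u) = |t - u|

theorem IsLine.shift {ω : X} {c : ℝ → X} (hc : IsLine ω c) (b : ℝ) :
    IsLine ω (fun t => c (t + b)) :=
  ⟨fun t => hc.1 _, fun t u => by rw [hc.2]; congr 1; ring⟩

theorem IsLine.reverse {ω : X} {c : ℝ → X} (hc : IsLine ω c) :
    IsLine ω (fun t => c (-t)) :=
  ⟨fun t => hc.1 _, fun t u => by rw [hc.2, abs_sub_comm]; congr 1; ring⟩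

theorem IsLine.map {ω : X} {c : ℝ → X} (hc : IsLine ω c) {f : X → X} (hf : IsConf f) {κ : ℝ}
    (hκ : 0 < κ) (h : ∀ x y, rd (f ω) (f x) (f y) = κ * rd ω x y) :
    IsLine (f ω) (fun t => f (c (t / κ))) := by
  refine ⟨fun t ht => hc.1 _ (hf.injective ht), fun t u => ?_⟩
  rw [h, hc.2, ← sub_div, abs_div, abs_of_pos hκ]
  field_simp

theorem IsLine.injective {ω : X} {c : ℝ → X} (hc : IsLine ω c) : Function.Injective c := by
  intro t u h
  have := hc.2 t u
  rw [h, rd_self] at this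
  exact sub_eq_zero.1 (abs_eq_zero.1 this.symm)

/-- A bounded sequence of points whose inverted distances to a fixed point tend to zero
converges to it. -/
theorem tendsto_of_rd [CompactSpace X] {ι : Type*} {l : Filter ι} {f : ι → X} {ω x : X} (hx : x ≠ ω)
    (hf : ∀ i, f i ≠ ω) (h : Tendsto (fun i => rd ω (f i) x) l (𝓝 0)) : Tendsto f l (𝓝 x) := by
  rw [tendsto_iff_dist_tendsto_zero]
  have hb : ∀ y z : X, dist y z ≤ Metric.diam (univ : Set X) := fun y z =>
    Metric.dist_le_diam_of_mem isCompact_univ.isBounded (mem_univ _) (mem_univ _)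
  refine squeeze_zero (g := fun i => rd ω (f i) x * (Metric.diam (univ : Set X) * dist x ω))
    (fun i => dist_nonneg) (fun i => ?_) (by simpa using h.mul_const _)
  rw [dist_eq_rd_mul (hf i) hx]
  have := rd_nonneg ω (f i) x
  have := hb (f i) ω
  gcongr

theorem IsLine.continuous [CompactSpace X] {ω : X} {c : ℝ → X} (hc : IsLine ω c) :
    Continuous c := by
  rw [continuous_iff_continuousAt]
  intro t
  refine tendsto_of_rd (hc.1 t) hc.1 ?_
  simp_rw [hc.2]
  have : Continuous fun u : ℝ => |u - t| := by fun_prop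
  simpa using this.tendsto t

theorem tendsto_remote_of_rd [CompactSpace X] {ι : Type*} {l : Filter ι} {f : ι → X} {ω x : X}
    (hx : x ≠ ω) (hf : ∀ i, f i ≠ ω) (h : Tendsto (fun i => rd ω (f i) x) l atTop) :
    Tendsto f l (𝓝 ω) := by
  rw [tendsto_iff_dist_tendsto_zero]
  have hb : ∀ y z : X, dist y z ≤ Metric.diam (univ : Set X) := fun y z =>
    Metric.dist_le_diam_of_mem isCompact_univ.isBounded (mem_univ _) (mem_univ _)
  have h0 := dist_pos.2 hx
  refine squeeze_zero' (g := fun i => Metric.diam (univ : Set X) / dist x ω / rd ω (f i) x)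
    (.of_forall fun i => dist_nonneg) ?_ (tendsto_const_nhds.div_atTop h)
  filter_upwards [h.eventually_gt_atTop 0] with i hi
  rw [le_div_iff₀ hi, le_div_iff₀ h0]
  calc _ = rd ω (f i) x * (dist (f i) ω * dist x ω) := by ring
    _ = dist (f i) x := (dist_eq_rd_mul (hf i) hx).symm
    _ ≤ _ := hb _ _

theorem exists_tendsto [CompactSpace X] {ι : Type*} (U : Ultrafilter ι) (f : ι → X) :
    ∃ x, Tendsto f U (𝓝 x) := by
  obtain ⟨x, -, hx⟩ := isCompact_univ.ultrafilter_le_nhds (U.map f) (by simp)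
  exact ⟨x, hx⟩

/-- If inverted distances from a convergent sequence tend to a finite positive limit, then
the limit point is neither remote nor the base point. -/
theorem ne_of_tendsto_rd {ι : Type*} {l : Filter ι} [NeBot l] {f g : ι → X} {ω p q : X} {r : ℝ}
    (hf : ∀ i, f i ≠ ω) (hg : ∀ i, g i ≠ ω) (hp : p ≠ ω) (hgp : Tendsto g l (𝓝 p))
    (hfq : Tendsto f l (𝓝 q)) (h : Tendsto (fun i => rd ω (f i) (g i)) l (𝓝 r)) :
    q ≠ ω ∧ rd ω q p = r := by
  have hq : q ≠ ω := by
    rintro rfl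
    have h1 : Tendsto (fun i => dist (f i) (g i)) l (𝓝 (dist q p)) := hfq.dist hgp
    have h2 : Tendsto (fun i => rd q (f i) (g i) * (dist (f i) q * dist (g i) q)) l
        (𝓝 (r * (dist q q * dist p q))) :=
      h.mul ((hfq.dist tendsto_const_nhds).mul (hgp.dist tendsto_const_nhds))
    have h3 : dist q p = r * (dist q q * dist p q) :=
      tendsto_nhds_unique h1 (h2.congr fun i => (dist_eq_rd_mul (hf i) (hg i)).symm)
    simp at h3
    exact hp h3.symm
  exact ⟨hq, tendsto_nhds_unique (tendsto_rd hfq hgp hq hp) h⟩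

/-- A pointwise limit of lines is a line. -/
theorem exists_limit_line [CompactSpace X] {ι : Type*} (U : Ultrafilter ι) {ω p : X} (hp : p ≠ ω)
    {c : ι → ℝ → X} (hc : ∀ i, IsLine ω (c i)) (h : Tendsto (fun i => c i 0) U (𝓝 p)) :
    ∃ e : ℝ → X, IsLine ω e ∧ e 0 = p ∧ ∀ t, Tendsto (fun i => c i t) U (𝓝 (e t)) := by
  choose e he using fun t => exists_tendsto U fun i => c i t
  have hne : ∀ t, e t ≠ ω := fun t =>
    (ne_of_tendsto_rd (fun i => (hc i).1 t) (fun i => (hc i).1 0) hp h (he t)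
      (r := |t - 0|) (by simp_rw [(hc _).2]; exact tendsto_const_nhds)).1
  refine ⟨e, ⟨hne, fun t u => ?_⟩, tendsto_nhds_unique (he 0) h, he⟩
  refine tendsto_nhds_unique (tendsto_rd (he t) (he u) (hne t) (hne u)) ?_
  simp_rw [(hc _).2]
  exact tendsto_const_nhds

/-- A pointwise limit of conformal maps is conformal, provided that three points have
distinct limits. -/
theorem exists_limit_conf [CompactSpace X] {ι : Type*} (U : Ultrafilter ι) {G : ι → X → X}
    (hG : ∀ i, IsConf (G i)) {a b c a' b' c' : X}
    (ha : Tendsto (fun i => G i a) U (𝓝 a')) (hb : Tendsto (fun i => G i b) U (𝓝 b'))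
    (hc : Tendsto (fun i => G i c) U (𝓝 c')) (hab : a' ≠ b') (hac : a' ≠ c') (hbc : b' ≠ c') :
    ∃ g : X → X, IsConf g ∧ ∀ x, Tendsto (fun i => G i x) U (𝓝 (g x)) := by
  choose g hg using fun x => exists_tendsto U fun i => G i x
  choose hsurj m hm hdist using hG
  have ea := tendsto_nhds_unique (hg a) ha
  have eb := tendsto_nhds_unique (hg b) hb
  have ec := tendsto_nhds_unique (hg c) hc
  have nab : a ≠ b := by rintro rfl; exact hab (ea.symm.trans eb)
  have nac : a ≠ c := by rintro rfl; exact hac (ea.symm.trans ec)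
  have nbc : b ≠ c := by rintro rfl; exact hbc (eb.symm.trans ec)
  -- convergence of the factors at a point of a triple
  have key : ∀ x y z : X, x ≠ y → x ≠ z → y ≠ z → g x ≠ g y → g x ≠ g z → g y ≠ g z →
      ∃ μ : ℝ, 0 < μ ∧ Tendsto (fun i => m i x) U (𝓝 μ) := by
    intro x y z h1 h2 h3 h4 h5 h6
    have p1 := dist_pos.2 h1; have p2 := dist_pos.2 h2; have p3 := dist_pos.2 h3
    have p4 := dist_pos.2 h4; have p5 := dist_pos.2 h5; have p6 := dist_pos.2 h6
    have hs : ∀ i, m i x = √(dist (G i x) (G i y) * dist (G i x) (G i z) / dist (G i y) (G i z) *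
        (dist y z / (dist x y * dist x z))) := by
      intro i
      rw [hdist, hdist, hdist]
      have h7 := hm i x; have := hm i y; have := hm i z
      rw [show m i x * m i y * dist x y * (m i x * m i z * dist x z) / (m i y * m i z * dist y z) *
        (dist y z / (dist x y * dist x z)) = m i x ^ 2 by field_simp]
      exact (Real.sqrt_sq h7.le).symm
    refine ⟨√(dist (g x) (g y) * dist (g x) (g z) / dist (g y) (g z) *
        (dist y z / (dist x y * dist x z))), by positivity, ?_⟩
    refine Tendsto.congr (fun i => (hs i).symm) ?_
    refine (Real.continuous_sqrt.tendsto _).comp ?_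
    exact ((((hg x).dist (hg y)).mul ((hg x).dist (hg z))).div
      ((hg y).dist (hg z)) p6.ne').mul_const _
  rw [← ea] at hab hac; rw [← eb] at hab hbc; rw [← ec] at hac hbc
  have hT : ∀ p ∈ ({a, b, c} : Set X), ∃ μ : ℝ, 0 < μ ∧ Tendsto (fun i => m i p) U (𝓝 μ) := by
    rintro p (rfl | rfl | rfl)
    · exact key _ b c nab nac nbc hab hac hbc
    · exact key _ a c nab.symm nbc nac hab.symm hbc hac
    · exact key _ a b nac.symm nbc.symm nab hac.symm hbc.symm hab
  have hP : ∀ x y : X, ∃ p ∈ ({a, b, c} : Set X), x ≠ p ∧ y ≠ g p := by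
    intro x y
    by_cases h1 : x = a
    · by_cases h2 : y = g b
      · exact ⟨c, by simp, h1 ▸ nac, h2 ▸ hbc⟩
      · exact ⟨b, by simp, h1 ▸ nab, h2⟩
    · by_cases h2 : y = g a
      · by_cases h3 : x = b
        · exact ⟨c, by simp, h3 ▸ nbc, h2 ▸ hac⟩
        · exact ⟨b, by simp, h3, h2 ▸ hab⟩
      · exact ⟨a, by simp, h1, h2⟩
  have hμ : ∀ x, ∃ μ : ℝ, 0 < μ ∧ Tendsto (fun i => m i x) U (𝓝 μ) := by
    intro x
    obtain ⟨p, hp, hxp, hgp⟩ := hP x (g x)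
    obtain ⟨μ, h0, h1⟩ := hT p hp
    have p1 := dist_pos.2 hxp; have p2 := dist_pos.2 hgp
    refine ⟨dist (g x) (g p) / (μ * dist x p), by positivity, ?_⟩
    refine Tendsto.congr (fun i => ?_)
      (((hg x).dist (hg p)).div (h1.mul_const (dist x p)) (by positivity))
    have := hm i p
    rw [Pi.div_apply, hdist]
    field_simp
  choose μ hμ0 hμ using hμ
  refine ⟨g, ⟨?_, μ, hμ0, fun x y => ?_⟩, hg⟩
  · intro x
    choose z hz using fun i => hsurj i x
    obtain ⟨w, hw⟩ := exists_tendsto U z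
    obtain ⟨p, hp, hxp, hgp⟩ := hP w x
    have p1 := dist_pos.2 hxp
    have p2 := hμ0 p
    have h1 : Tendsto (fun i => dist x (G i p) / (m i p * dist (z i) p)) U
        (𝓝 (dist x (g p) / (μ p * dist w p))) :=
      (tendsto_const_nhds.dist (hg p)).div ((hμ p).mul (hw.dist tendsto_const_nhds))
        (by positivity)
    have h2 : Tendsto (fun i => m i (z i)) U (𝓝 (dist x (g p) / (μ p * dist w p))) := by
      refine h1.congr' ?_
      filter_upwards [(hw.dist (tendsto_const_nhds (x := p))).eventually_const_lt p1] with i hi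
      have := hm i p
      rw [← hz i, hdist]
      field_simp
    have h3 : Tendsto (fun i => m i (z i) * m i w * dist (z i) w) U (𝓝 0) := by
      simpa using (h2.mul (hμ w)).mul (hw.dist (tendsto_const_nhds (x := w)))
    have h4 : Tendsto (fun i => dist x (G i w)) U (𝓝 (dist x (g w))) :=
      tendsto_const_nhds.dist (hg w)
    refine ⟨w, (dist_eq_zero.1 (tendsto_nhds_unique h4 (h3.congr fun i => ?_))).symm⟩
    rw [← hdist, hz]
  · refine tendsto_nhds_unique ((hg x).dist (hg y)) ?_
    simp_rw [hdist]
    exact ((hμ x).mul (hμ y)).mul_const _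
end

section
open Filter Topology Set
variable {X : Type*} [MetricSpace X]

/-- Existence of an inversion of every radius for every pair of points. -/
def HasInversions (X : Type*) [MetricSpace X] : Prop :=
  ∀ ω o : X, ω ≠ o → ∀ r : ℝ, 0 < r → ∃ φ : X → X, IsConf φ ∧ (∀ x, φ (φ x) = x) ∧
    (∀ x, φ x ≠ x) ∧ φ ω = o ∧ (∀ x, x ≠ ω → rd ω x o = r → rd ω (φ x) o = r) ∧
    ∀ c, IsLine ω c → c 0 = o → ∀ t, φ (c t) ∈ range c ∨ φ (c t) = ω

/-- `φ` is an inversion of radius `r` centered at `o` in the space with remote point `ω`. -/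
structure IsInv (ω o : X) (r : ℝ) (φ : X → X) : Prop where
  conf : IsConf φ
  invol : ∀ x, φ (φ x) = x
  remote : φ ω = o
  center : φ o = ω
  rd_map : ∀ x y, x ≠ ω → x ≠ o → y ≠ ω → y ≠ o →
    rd ω (φ x) (φ y) = r ^ 2 * rd ω x y / (rd ω x o * rd ω y o)
  rd_center : ∀ x, x ≠ ω → x ≠ o → rd ω (φ x) o = r ^ 2 / rd ω x o
  line : ∀ c, IsLine ω c → c 0 = o → ∀ t, t ≠ 0 → φ (c t) = c (-(r ^ 2) / t)

/-- `h` is a homothety of factor `l` centered at `o` in the space with remote point `ω`. -/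
structure IsHom (ω o : X) (l : ℝ) (h : X → X) : Prop where
  conf : IsConf h
  remote : h ω = ω
  center : h o = o
  rd_map : ∀ x y, rd ω (h x) (h y) = l * rd ω x y
  line : ∀ c, IsLine ω c → ∀ t₀, c t₀ = o → ∀ t, h (c t) = c (t₀ + l * (t - t₀))

theorem exists_inv_of_sphere (hinv : HasInversions X) {ω o : X} (ho : o ≠ ω) {r : ℝ} (hr : 0 < r)
    (hs : ∃ x, x ≠ ω ∧ rd ω x o = r) : ∃ φ, IsInv ω o r φ := by
  obtain ⟨φ, hc, hi, hf, hω, hsph, hl⟩ := hinv ω o ho.symm r hr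
  have hoω : φ o = ω := by rw [← hω, hi]
  obtain ⟨κ, hκ, hmap⟩ := hc.exists_factor ω
  rw [hω] at hmap
  have hne : ∀ x, x ≠ ω → φ x ≠ o := fun x hx h => hx (hc.injective (h.trans hω.symm))
  have hne' : ∀ x, x ≠ o → φ x ≠ ω := fun x hx h => hx (hc.injective (h.trans hoω.symm))
  have h1 := dist_pos.2 ho.symm
  have hK : 0 < (dist ω o ^ 2)⁻¹ / κ := by positivity
  have hc1 : ∀ x, x ≠ ω → x ≠ o → rd ω (φ x) o = (dist ω o ^ 2)⁻¹ / κ / rd ω x o := by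
    intro x hx hxo
    rw [rd_inv_remote (hne x hx) (hne' x hxo) ho.symm]
    have e : rd o (φ x) ω = κ * rd ω x o := by rw [← hmap, hoω]
    rw [e]
    have := rd_pos hx ho hxo
    field_simp
  have hc2 : ∀ x y, x ≠ ω → x ≠ o → y ≠ ω → y ≠ o →
      rd ω (φ x) (φ y) = (dist ω o ^ 2)⁻¹ / κ * rd ω x y / (rd ω x o * rd ω y o) := by
    intro x y hx hxo hy hyo
    rw [rd_inv (hne x hx) (hne y hy) ho.symm]
    have e : ∀ x, rd o (φ x) ω = κ * rd ω x o := fun x => by rw [← hmap, hoω]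
    rw [e, e, hmap]
    have := rd_pos hx ho hxo; have := rd_pos hy ho hyo
    field_simp
  have hKr : (dist ω o ^ 2)⁻¹ / κ = r ^ 2 := by
    obtain ⟨x, hx, hxr⟩ := hs
    have hxo : x ≠ o := by rintro rfl; rw [rd_self] at hxr; exact hr.ne hxr
    have h2 := hc1 x hx hxo
    rw [hsph x hx hxr, hxr, eq_div_iff hr.ne'] at h2
    rw [← h2]; ring
  rw [hKr] at hc1 hc2
  refine ⟨φ, hc, hi, hω, hoω, hc2, hc1, fun c hcl hc0 => ?_⟩
  have hto : ∀ t, t ≠ 0 → c t ≠ o := fun t ht h => ht (hcl.injective (h.trans hc0.symm))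
  have hd : ∀ t, rd ω (c t) o = |t| := fun t => by rw [← hc0, hcl.2, sub_zero]
  have hs : ∀ t, t ≠ 0 → ∃ s, φ (c t) = c s ∧ (s = r ^ 2 / t ∨ s = -(r ^ 2) / t) := by
    intro t ht
    rcases hl c hcl hc0 t with ⟨s, hs⟩ | h
    · refine ⟨s, hs.symm, ?_⟩
      have h2 := hc1 _ (hcl.1 t) (hto t ht)
      rw [← hs, hd, hd] at h2
      have : |s| = |r ^ 2 / t| := by rw [h2, abs_div, abs_of_pos (by positivity : 0 < r ^ 2)]
      rcases abs_eq_abs.1 this with h | h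
      · exact .inl h
      · right; rw [h, neg_div]
    · exact absurd h (hne' _ (hto t ht))
  have hsr : φ (c r) = c (-r) := by
    obtain ⟨s, h2, h3⟩ := hs r hr.ne'
    rcases h3 with h3 | h3
    · rw [show s = r by rw [h3]; field_simp] at h2
      exact absurd h2 (hf _)
    · rwa [show s = -r by rw [h3]; field_simp] at h2
  intro t ht
  obtain ⟨s, h2, h3⟩ := hs t ht
  rcases h3 with h3 | h3
  · exfalso
    have h4 := hc2 (c t) (c r) (hcl.1 _) (hto _ ht) (hcl.1 _) (hto _ hr.ne')
    rw [h2, hsr, hcl.2, hcl.2, hd, hd, h3, abs_of_pos hr] at h4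
    have h5 : r ^ 2 / t - -r = r * (r + t) / t := by field_simp; ring
    have h6 := abs_pos.2 ht
    rw [h5, abs_div, abs_mul, abs_of_pos hr] at h4
    have h7 : |r + t| = |t - r| := by
      field_simp at h4
      linarith
    rcases abs_eq_abs.1 h7 with h | h
    · linarith
    · exact ht (by linarith)
  · rw [h2, h3]

theorem IsLine.rd_eventually [CompactSpace X] (hpt : PtolemyIneq X) {ω : X} {c : ℝ → X}
    (hc : IsLine ω c) {x : X} (hx : x ≠ ω) {r : ℝ} (hr : rd ω x (c 0) ≤ r) :
    ∃ t, rd ω (c t) x = r := by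
  have hcont : Continuous fun t => rd ω (c t) x := by
    rw [continuous_iff_continuousAt]
    intro t
    exact tendsto_rd (hc.continuous.tendsto t) tendsto_const_nhds (hc.1 t) hx
  have h1 : rd ω (c 0) x ≤ r := by rwa [rd_comm]
  have h2 : r ≤ rd ω (c (2 * r)) x := by
    have h3 := rd_triangle hpt (hc.1 (2 * r)) hx (hc.1 0)
    rw [hc.2, sub_zero] at h3
    have := le_abs_self (2 * r)
    linarith
  obtain ⟨t, -, ht⟩ := mem_range_of_exists_le_of_exists_ge hcont ⟨0, h1⟩ ⟨_, h2⟩ |>.imp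
    fun t ht => (⟨trivial, ht⟩ : True ∧ _)
  exact ⟨t, ht⟩

theorem IsInv.comp_factor {ω o : X} (ho : o ≠ ω) {r₁ r₂ : ℝ} {φ₁ φ₂ : X → X}
    (h1 : IsInv ω o r₁ φ₁) (h2 : IsInv ω o r₂ φ₂) (hr₁ : 0 < r₁) {y : X} (hy : y ≠ ω)
    (hyo : y ≠ o) :
    IsConf (fun x => φ₂ (φ₁ x)) ∧ φ₂ (φ₁ ω) = ω ∧ φ₂ (φ₁ o) = o ∧
      ∀ x y, rd ω (φ₂ (φ₁ x)) (φ₂ (φ₁ y)) = (r₂ / r₁) ^ 2 * rd ω x y := by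
  have e1 : φ₂ (φ₁ ω) = ω := by rw [h1.remote, h2.center]
  have e2 : φ₂ (φ₁ o) = o := by rw [h1.center, h2.remote]
  refine ⟨h2.conf.comp h1.conf, e1, e2, ?_⟩
  obtain ⟨κ, hκ, hmap⟩ := (h2.conf.comp h1.conf).exists_factor ω
  rw [e1] at hmap
  have h3 := hmap y o
  rw [e2] at h3
  have n1 : φ₁ y ≠ o := fun h => hy (h1.conf.injective (h.trans h1.remote.symm))
  have n2 : φ₁ y ≠ ω := fun h => hyo (h1.conf.injective (h.trans h1.center.symm))
  rw [h2.rd_center _ n2 n1, h1.rd_center y hy hyo] at h3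
  have := rd_pos hy ho hyo
  have h4 : κ = (r₂ / r₁) ^ 2 := by
    field_simp at h3 ⊢
    linarith
  rw [← h4]
  exact hmap

theorem exists_scaling [CompactSpace X] (hpt : PtolemyIneq X) (hinv : HasInversions X) {ω x : X}
    (hx : x ≠ ω) {c : ℝ → X} (hc : IsLine ω c) {l : ℝ} (hl : 0 < l) :
    ∃ h : X → X, IsConf h ∧ h ω = ω ∧ h x = x ∧ ∀ y z, rd ω (h y) (h z) = l * rd ω y z := by
  obtain ⟨y, hy, hyx⟩ : ∃ y, y ≠ ω ∧ y ≠ x := by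
    rcases eq_or_ne (c 0) x with h | h
    · refine ⟨c 1, hc.1 _, ?_⟩
      rw [← h]
      exact fun h => one_ne_zero (hc.injective h)
    · exact ⟨c 0, hc.1 _, h⟩
  have hR : ∀ r, rd ω x (c 0) + 1 ≤ r → ∃ φ, IsInv ω x r φ := by
    intro r hr
    obtain ⟨t, ht⟩ := hc.rd_eventually hpt hx (show rd ω x (c 0) ≤ r by linarith)
    have := rd_nonneg ω x (c 0)
    exact exists_inv_of_sphere hinv hx (by linarith) ⟨_, hc.1 t, ht⟩
  have h0 := rd_nonneg ω x (c 0)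
  set R := rd ω x (c 0) + 1
  have hR0 : 0 < R := by linarith
  have hs : 0 < √l := Real.sqrt_pos.2 hl
  obtain ⟨r₁, r₂, h1, h2, h3⟩ : ∃ r₁ r₂, R ≤ r₁ ∧ R ≤ r₂ ∧ (r₂ / r₁) ^ 2 = l := by
    refine ⟨R * (1 + 1 / √l), R * (1 + √l), ?_, ?_, ?_⟩
    · have : 0 < 1 / √l := by positivity
      nlinarith
    · nlinarith
    · rw [show R * (1 + √l) / (R * (1 + 1 / √l)) = √l by field_simp; ring]
      exact Real.sq_sqrt hl.le
  obtain ⟨φ₁, hφ₁⟩ := hR r₁ h1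
  obtain ⟨φ₂, hφ₂⟩ := hR r₂ h2
  obtain ⟨h4, h5, h6, h7⟩ := hφ₁.comp_factor hx hφ₂ (by linarith) hy hyx
  rw [h3] at h7
  exact ⟨_, h4, h5, h6, h7⟩

theorem IsLine.exists_through [CompactSpace X] (hpt : PtolemyIneq X) (hinv : HasInversions X)
    {ω x : X} (hx : x ≠ ω) {c : ℝ → X} (hc : IsLine ω c) : ∃ e, IsLine ω e ∧ e 0 = x := by
  have hl : ∀ i : ℕ, (0 : ℝ) < 1 / ((i : ℝ) + 1) := fun i => by positivity
  choose h h1 h2 h3 h4 using fun i : ℕ => exists_scaling hpt hinv hx hc (hl i)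
  have hline : ∀ i, IsLine ω fun t => h i (c (t / (1 / ((i : ℝ) + 1)))) := fun i => by
    have := hc.map (h1 i) (hl i) (by rw [h2]; exact h4 i)
    rwa [h2] at this
  obtain ⟨e, he, he0, -⟩ := exists_limit_line (hyperfilter ℕ) hx hline (by
    refine tendsto_of_rd hx (fun i => (hline i).1 0) ?_
    have h5 : ∀ i, rd ω (h i (c (0 / (1 / ((i : ℝ) + 1))))) x =
        1 / ((i : ℝ) + 1) * rd ω (c 0) x := fun i => by
      conv_lhs => rw [← h3 i, h4, zero_div]
    simp_rw [h5]
    have h6 : Tendsto (fun i : ℕ => 1 / ((i : ℝ) + 1) * rd ω (c 0) x) atTop (𝓝 0) := by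
      simpa using tendsto_one_div_add_atTop_nhds_zero_nat.mul_const (rd ω (c 0) x)
    exact h6.mono_left (Nat.hyperfilter_le_atTop))
  exact ⟨e, he, he0⟩

open Classical in
/-- The unit speed parametrization of a line after making one of its points remote. -/
noncomputable def relLine (ω : X) (c : ℝ → X) (t₀ u : ℝ) : X :=
  if u = 0 then ω else c (t₀ - (dist (c t₀) ω ^ 2)⁻¹ / u)

theorem relLine_zero (ω : X) (c : ℝ → X) (t₀ : ℝ) : relLine ω c t₀ 0 = ω := if_pos rfl

theorem relLine_of_ne (ω : X) (c : ℝ → X) (t₀ : ℝ) {u : ℝ} (hu : u ≠ 0) :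
    relLine ω c t₀ u = c (t₀ - (dist (c t₀) ω ^ 2)⁻¹ / u) := if_neg hu

theorem isLine_relLine {ω : X} {c : ℝ → X} (hc : IsLine ω c) (t₀ : ℝ) :
    IsLine (c t₀) (relLine ω c t₀) := by
  have h0 := dist_pos.2 (hc.1 t₀)
  have hK : 0 < (dist (c t₀) ω ^ 2)⁻¹ := by positivity
  have hne : ∀ u : ℝ, u ≠ 0 → c (t₀ - (dist (c t₀) ω ^ 2)⁻¹ / u) ≠ c t₀ := by
    intro u hu h
    have h1 := hc.injective h
    have : (dist (c t₀) ω ^ 2)⁻¹ / u ≠ 0 := div_ne_zero hK.ne' hu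
    exact this (by linarith)
  have hd : ∀ u : ℝ, u ≠ 0 →
      rd ω (c (t₀ - (dist (c t₀) ω ^ 2)⁻¹ / u)) (c t₀) = (dist (c t₀) ω ^ 2)⁻¹ / |u| := by
    intro u hu
    rw [hc.2, show t₀ - (dist (c t₀) ω ^ 2)⁻¹ / u - t₀ = -((dist (c t₀) ω ^ 2)⁻¹ / u) by ring,
      abs_neg, abs_div, abs_of_pos hK]
  have hr : ∀ u : ℝ, u ≠ 0 → rd (c t₀) (c (t₀ - (dist (c t₀) ω ^ 2)⁻¹ / u)) ω = |u| := by
    intro u hu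
    rw [rd_inv_remote (hc.1 _) (hne u hu) (hc.1 _), hd u hu]
    have := abs_pos.2 hu
    field_simp
  refine ⟨fun u => ?_, fun u v => ?_⟩
  · rcases eq_or_ne u 0 with rfl | hu
    · rw [relLine_zero]; exact (hc.1 t₀).symm
    · rw [relLine_of_ne _ _ _ hu]; exact hne u hu
  · rcases eq_or_ne u 0 with rfl | hu <;> rcases eq_or_ne v 0 with rfl | hv
    · simp [rd_self]
    · rw [relLine_zero, relLine_of_ne _ _ _ hv, rd_comm, hr v hv]; simp
    · rw [relLine_zero, relLine_of_ne _ _ _ hu, hr u hu]; simp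
    · rw [relLine_of_ne _ _ _ hu, relLine_of_ne _ _ _ hv,
        rd_inv (hc.1 _) (hc.1 _) (hc.1 _), hd u hu, hd v hv, hc.2]
      have h1 := abs_pos.2 hu; have h2 := abs_pos.2 hv
      rw [show t₀ - (dist (c t₀) ω ^ 2)⁻¹ / u - (t₀ - (dist (c t₀) ω ^ 2)⁻¹ / v) =
        (dist (c t₀) ω ^ 2)⁻¹ * (u - v) / (u * v) by field_simp; ring, abs_div, abs_mul, abs_mul,
        abs_of_pos hK]
      field_simp

/-- The standing assumptions: the Ptolemy inequality, existence of inversions and of a line. -/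
structure IsNice (X : Type*) [MetricSpace X] : Prop where
  ptolemy : PtolemyIneq X
  inv : HasInversions X
  line : ∃ (ω : X) (c : ℝ → X), IsLine ω c

variable [CompactSpace X]

theorem IsNice.exists_line (hX : IsNice X) {ω o : X} (ho : o ≠ ω) : ∃ c, IsLine ω c ∧ c 0 = o := by
  obtain ⟨ω₀, c, hc⟩ := hX.line
  rcases eq_or_ne ω ω₀ with rfl | h
  · exact hc.exists_through hX.ptolemy hX.inv ho
  · obtain ⟨e, he, he0⟩ := hc.exists_through hX.ptolemy hX.inv h
    have h1 := isLine_relLine he 0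
    rw [he0] at h1
    exact h1.exists_through hX.ptolemy hX.inv ho

theorem IsNice.exists_inv (hX : IsNice X) {ω o : X} (ho : o ≠ ω) {r : ℝ} (hr : 0 < r) :
    ∃ φ, IsInv ω o r φ := by
  obtain ⟨c, hc, hc0⟩ := hX.exists_line ho
  refine exists_inv_of_sphere hX.inv ho hr ⟨c r, hc.1 _, ?_⟩
  rw [← hc0, hc.2, sub_zero, abs_of_pos hr]

theorem IsNice.exists_hom (hX : IsNice X) {ω o : X} (ho : o ≠ ω) {l : ℝ} (hl : 0 < l) :
    ∃ h, IsHom ω o l h := by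
  have hs : 0 < √l := Real.sqrt_pos.2 hl
  obtain ⟨φ₁, h1⟩ := hX.exists_inv ho one_pos
  obtain ⟨φ₂, h2⟩ := hX.exists_inv ho hs
  obtain ⟨c, hc, hc0⟩ := hX.exists_line ho
  obtain ⟨h4, h5, h6, h7⟩ := h1.comp_factor ho h2 one_pos (hc.1 1)
    (by rw [← hc0]; exact fun h => one_ne_zero (hc.injective h))
  rw [div_one, Real.sq_sqrt hl.le] at h7
  refine ⟨_, h4, h5, h6, h7, fun c hc t₀ ht₀ t => ?_⟩
  have hsh := hc.shift t₀
  rcases eq_or_ne t t₀ with rfl | hne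
  · simp [ht₀, h6]
  · have hne' := sub_ne_zero.2 hne
    have e1 := h1.line _ hsh (by simpa using ht₀) _ hne'
    have e2 := h2.line _ hsh (by simpa using ht₀) (-(1 ^ 2) / (t - t₀))
      (by rw [neg_div]; exact neg_ne_zero.2 (by positivity))
    simp only [sub_add_cancel] at e1 e2
    rw [e1, e2, Real.sq_sqrt hl.le]
    congr 1
    field_simp
    ring

/-- Lines through two common points coincide. -/
theorem IsLine.eq_of_eq (hX : IsNice X) {ω : X} {e e' : ℝ → X} (he : IsLine ω e)
    (he' : IsLine ω e') {t₀ t₁ : ℝ} (h : t₀ < t₁) (h0 : e t₀ = e' t₀) (h1 : e t₁ = e' t₁) :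
    e = e' := by
  have hr : ∀ t, t₀ < t → e t = e' t := by
    intro t ht
    obtain ⟨g, hg⟩ := hX.exists_hom (he.1 t₀) (l := (t - t₀) / (t₁ - t₀))
      (div_pos (by linarith) (by linarith))
    have e1 := hg.line e he t₀ rfl t₁
    have e2 := hg.line e' he' t₀ h0.symm t₁
    have h3 : t₁ - t₀ ≠ 0 := by linarith
    rw [show t₀ + (t - t₀) / (t₁ - t₀) * (t₁ - t₀) = t by field_simp; ring] at e1 e2
    rw [← e1, ← e2, h1]
  funext t
  rcases le_or_gt t t₁ with ht | ht
  · obtain ⟨g, hg⟩ := hX.exists_hom (he.1 t₁) (l := (t₁ - t + 1) / (t₁ - t₀))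
      (div_pos (by linarith) (by linarith))
    obtain ⟨s, hs, hst⟩ : ∃ s, t₀ < s ∧ t = t₁ + (t₁ - t + 1) / (t₁ - t₀) * (s - t₁) := by
      have h3 : t₁ - t₀ ≠ 0 := by linarith
      have h4 : t₁ - t + 1 ≠ 0 := by linarith
      refine ⟨t₁ - (t₁ - t) * (t₁ - t₀) / (t₁ - t + 1), ?_, by field_simp; ring⟩
      have : (t₁ - t) * (t₁ - t₀) / (t₁ - t + 1) < t₁ - t₀ := by
        rw [div_lt_iff₀ (by linarith)]
        nlinarith
      linarith
    have e1 := hg.line e he t₁ rfl s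
    have e2 := hg.line e' he' t₁ h1.symm s
    rw [hst, ← e1, ← e2, hr s hs]
  · exact hr t (by linarith)

end

section
open Filter Topology Set
variable {X : Type*} [MetricSpace X]

/-- The Busemann function of a line, normalized to be increasing along the line. -/
noncomputable def bus (ω : X) (c : ℝ → X) (x : X) : ℝ := ⨆ t : ℝ, (t - rd ω x (c t))

theorem IsLine.bddAbove (hpt : PtolemyIneq X) {ω : X} {c : ℝ → X} (hc : IsLine ω c) {x : X}
    (hx : x ≠ ω) : BddAbove (range fun t : ℝ => t - rd ω x (c t)) := by
  refine ⟨rd ω x (c 0), ?_⟩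
  rintro _ ⟨t, rfl⟩
  have h := rd_triangle hpt (hc.1 0) hx (hc.1 t)
  rw [hc.2, rd_comm ω (c 0) x, zero_sub, abs_neg] at h
  have := le_abs_self t
  simp only
  linarith

theorem IsLine.le_bus (hpt : PtolemyIneq X) {ω : X} {c : ℝ → X} (hc : IsLine ω c) {x : X}
    (hx : x ≠ ω) (t : ℝ) : t - rd ω x (c t) ≤ bus ω c x :=
  le_ciSup (hc.bddAbove hpt hx) t

theorem IsLine.tendsto_bus (hpt : PtolemyIneq X) {ω : X} {c : ℝ → X} (hc : IsLine ω c) {x : X}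
    (hx : x ≠ ω) : Tendsto (fun t : ℝ => t - rd ω x (c t)) atTop (𝓝 (bus ω c x)) := by
  refine tendsto_atTop_ciSup (fun s t hst => ?_) (hc.bddAbove hpt hx)
  have h := rd_triangle hpt hx (hc.1 s) (hc.1 t)
  rw [hc.2, abs_of_nonpos (by linarith)] at h
  linarith

theorem IsLine.bus_apply (hpt : PtolemyIneq X) {ω : X} {c : ℝ → X} (hc : IsLine ω c) (t : ℝ) :
    bus ω c (c t) = t := by
  refine tendsto_nhds_unique (hc.tendsto_bus hpt (hc.1 t)) ?_
  refine tendsto_const_nhds.congr' ?_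
  filter_upwards [eventually_ge_atTop t] with s hs
  rw [hc.2, abs_of_nonpos (by linarith)]
  ring

theorem IsLine.bus_sub_le (hpt : PtolemyIneq X) {ω : X} {c : ℝ → X} (hc : IsLine ω c) {x y : X}
    (hx : x ≠ ω) (hy : y ≠ ω) : bus ω c x - bus ω c y ≤ rd ω x y := by
  refine le_of_tendsto ((hc.tendsto_bus hpt hx).sub (hc.tendsto_bus hpt hy))
    (.of_forall fun t => ?_)
  have h := rd_triangle hpt hy hx (hc.1 t)
  rw [rd_comm ω y x] at h
  linarith

theorem IsLine.abs_bus_sub_le (hpt : PtolemyIneq X) {ω : X} {c : ℝ → X} (hc : IsLine ω c) {x y : X}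
    (hx : x ≠ ω) (hy : y ≠ ω) : |bus ω c x - bus ω c y| ≤ rd ω x y :=
  abs_le.2 ⟨by linarith [hc.bus_sub_le hpt hy hx, rd_comm ω x y], hc.bus_sub_le hpt hx hy⟩

theorem IsLine.tendsto_bus_of_tendsto (hpt : PtolemyIneq X) {ω : X} {c : ℝ → X} (hc : IsLine ω c)
    {ι : Type*} {l : Filter ι} {f : ι → X} {x : X} (hx : x ≠ ω) (hf : Tendsto f l (𝓝 x)) :
    Tendsto (fun i => bus ω c (f i)) l (𝓝 (bus ω c x)) := by
  rw [tendsto_iff_dist_tendsto_zero]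
  have h := tendsto_rd hf tendsto_const_nhds hx hx
  rw [rd_self] at h
  refine squeeze_zero' (.of_forall fun i => dist_nonneg) ?_ h
  filter_upwards [hf.eventually_ne hx] with i hi
  exact hc.abs_bus_sub_le hpt hi hx

theorem IsLine.bus_shift (hpt : PtolemyIneq X) {ω : X} {c : ℝ → X} (hc : IsLine ω c) {x : X}
    (hx : x ≠ ω) (b : ℝ) : bus ω (fun t => c (t + b)) x = bus ω c x - b := by
  refine tendsto_nhds_unique ((hc.shift b).tendsto_bus hpt hx) ?_
  refine (((hc.tendsto_bus hpt hx).comp (tendsto_atTop_add_const_right _ b tendsto_id)).sub_const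
    b).congr fun t => ?_
  simp only [Function.comp, id]
  ring

theorem IsLine.bus_hom (hpt : PtolemyIneq X) {ω : X} {c : ℝ → X} (hc : IsLine ω c) {l : ℝ}
    (hl : 0 < l) {h : X → X} (hh : IsHom ω (c 0) l h) {x : X} (hx : x ≠ ω) :
    bus ω c (h x) = l * bus ω c x := by
  have hx' : h x ≠ ω := fun h' => hx (hh.conf.injective (h'.trans hh.remote.symm))
  refine tendsto_nhds_unique (((hc.tendsto_bus hpt hx').comp
    (tendsto_id.const_mul_atTop hl))) ?_
  refine ((hc.tendsto_bus hpt hx).const_mul l).congr fun t => ?_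
  have h1 := hh.line c hc 0 rfl t
  simp only [sub_zero, zero_add] at h1
  simp only [Function.comp, id]
  rw [← h1, hh.rd_map]
  ring

/-- Distances to a point are convex along lines. -/
theorem IsLine.rd_convex (hpt : PtolemyIneq X) {ω : X} {e : ℝ → X} (he : IsLine ω e) {x : X}
    (hx : x ≠ ω) {a b c : ℝ} (hab : a ≤ b) (hbc : b ≤ c) :
    rd ω x (e b) * (c - a) ≤ rd ω x (e a) * (c - b) + rd ω x (e c) * (b - a) := by
  have h := rd_ptolemy hpt hx (he.1 a) (he.1 b) (he.1 c)
  rwa [he.2, he.2, he.2, abs_of_nonpos (by linarith), abs_of_nonpos (by linarith),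
    abs_of_nonpos (by linarith), neg_sub, neg_sub, neg_sub] at h

theorem relLine_rd {ω : X} {c : ℝ → X} (hc : IsLine ω c) {x : X} (hx : x ≠ ω)
    (hxo : x ≠ c 0) {s : ℝ} (hs : s ≠ 0) :
    rd ω x (c s) = rd ω x (c 0) * |s| * rd (c 0) x (relLine ω c 0 (-(dist (c 0) ω ^ 2)⁻¹ / s)) /
      (dist (c 0) ω ^ 2)⁻¹ := by
  have h0 := dist_pos.2 (hc.1 0)
  have h1 := rd_pos hx (hc.1 0) hxo
  have h2 := abs_pos.2 hs
  rw [relLine_of_ne _ _ _ (by simp [hs, h0.ne'])]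
  rw [show 0 - (dist (c 0) ω ^ 2)⁻¹ / (-(dist (c 0) ω ^ 2)⁻¹ / s) = s by field_simp; simp,
    rd_inv hx (hc.1 _) (hc.1 _), hc.2, sub_zero]
  field_simp

/-- If the distance to `x` is differentiable at the remote point, the two Busemann functions
of the line cancel. -/
theorem bus_add_reverse_of_differentiableAt (hpt : PtolemyIneq X) {ω : X} {c : ℝ → X}
    (hc : IsLine ω c) {x : X} (hx : x ≠ ω) (hxo : x ≠ c 0)
    (hd : DifferentiableAt ℝ (fun u => rd (c 0) x (relLine ω c 0 u)) 0) :
    bus ω c x + bus ω (fun t => c (-t)) x = 0 := by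
  set g := fun u => rd (c 0) x (relLine ω c 0 u) with hg
  set K := (dist (c 0) ω ^ 2)⁻¹ with hK
  set R := rd ω x (c 0) with hR
  have h0 := dist_pos.2 (hc.1 0)
  have hK0 : 0 < K := by positivity
  have hR0 : 0 < R := rd_pos hx (hc.1 0) hxo
  have hg0 : g 0 = K / R := by
    simp only [hg, relLine_zero]
    rw [rd_inv_remote hx hxo (hc.1 0)]
  have hslope := hasDerivAt_iff_tendsto_slope.1 hd.hasDerivAt
  have hu : ∀ k : ℝ, k ≠ 0 → Tendsto (fun t : ℝ => k / t) atTop (𝓝[≠] 0) := by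
    intro k hk
    refine tendsto_nhdsWithin_iff.2 ⟨tendsto_const_nhds.div_atTop tendsto_id, ?_⟩
    filter_upwards [eventually_gt_atTop 0] with t ht
    exact div_ne_zero hk ht.ne'
  have l1 : bus ω c x = R * deriv g 0 := by
    refine tendsto_nhds_unique (hc.tendsto_bus hpt hx) ?_
    refine ((hslope.comp (hu (-K) (by linarith))).const_mul R).congr' ?_
    filter_upwards [eventually_gt_atTop 0] with t ht
    rw [relLine_rd hc hx hxo ht.ne']
    change R * slope g 0 (-K / t) = t - R * |t| * g (-K / t) / K
    rw [slope_def_field, hg0, sub_zero, abs_of_pos ht]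
    generalize g (-K / t) = G
    clear_value K R
    field_simp
    ring
  have l2 : bus ω (fun t => c (-t)) x = -R * deriv g 0 := by
    refine tendsto_nhds_unique (hc.reverse.tendsto_bus hpt hx) ?_
    refine ((hslope.comp (hu K (by linarith))).const_mul (-R)).congr' ?_
    filter_upwards [eventually_gt_atTop 0] with t ht
    rw [relLine_rd hc hx hxo (neg_ne_zero.2 ht.ne')]
    change -R * slope g 0 (K / t) = t - R * |-t| * g (-K / -t) / K
    rw [slope_def_field, hg0, sub_zero, abs_neg, abs_of_pos ht, neg_div_neg_eq]
    generalize g (K / t) = G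
    clear_value K R
    field_simp
    ring
  rw [l1, l2]; ring

theorem IsLine.bus_reverse_apply (hpt : PtolemyIneq X) {ω : X} {c : ℝ → X} (hc : IsLine ω c)
    (t : ℝ) : bus ω (fun t => c (-t)) (c t) = -t := by
  have := hc.reverse.bus_apply hpt (-t)
  rwa [neg_neg] at this

theorem IsLine.bus_reverse [CompactSpace X] (hX : IsNice X) {ω : X} {c : ℝ → X}
    (hc : IsLine ω c) {x : X} (hx : x ≠ ω) :
    bus ω (fun t => c (-t)) x = -bus ω c x := by
  have hpt := hX.ptolemy
  by_cases hxc : x ∈ range c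
  · obtain ⟨t, rfl⟩ := hxc
    rw [hc.bus_apply hpt, hc.bus_reverse_apply hpt]
  have hxo : x ≠ c 0 := fun h => hxc ⟨0, h.symm⟩
  set e := relLine ω c 0 with he_def
  have he : IsLine (c 0) e := isLine_relLine hc 0
  have he0 : e 0 = ω := relLine_zero _ _ _
  set g := fun u => rd (c 0) x (e u) with hg
  have hlip : LipschitzWith 1 g := by
    refine LipschitzWith.of_dist_le_mul fun u v => ?_
    rw [NNReal.coe_one, one_mul, Real.dist_eq, Real.dist_eq, ← he.2 u v]
    have h1 := rd_triangle hpt hxo (he.1 u) (he.1 v)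
    have h2 := rd_triangle hpt hxo (he.1 v) (he.1 u)
    rw [rd_comm (c 0) (e v) (e u)] at h2
    have h3 : |rd (c 0) x (e u) - rd (c 0) x (e v)| ≤ rd (c 0) (e u) (e v) :=
      abs_le.2 ⟨by linarith, by linarith⟩
    exact h3
  have hdense : Dense {u | DifferentiableAt ℝ g u} :=
    MeasureTheory.Measure.dense_of_ae (μ := MeasureTheory.volume) hlip.ae_differentiableAt_of_real
  have hex : ∀ i : ℕ, ∃ u : ℝ, DifferentiableAt ℝ g u ∧ 0 < u ∧ u < 1 / ((i : ℝ) + 1) := by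
    intro i
    obtain ⟨u, hu, hu'⟩ := hdense.exists_mem_open
      (isOpen_Ioo (a := (0 : ℝ)) (b := 1 / ((i : ℝ) + 1)))
      (nonempty_Ioo.2 (by positivity))
    exact ⟨u, hu, hu'.1, hu'.2⟩
  choose u hud hu0 hu1 using hex
  have hulim : Tendsto u atTop (𝓝 0) :=
    squeeze_zero (fun i => (hu0 i).le) (fun i => (hu1 i).le) tendsto_one_div_add_atTop_nhds_zero_nat
  have hl : ∀ i, 0 < 1 / (1 + u i) := fun i => by have := hu0 i; positivity
  choose h hh using fun i => hX.exists_hom (he.1 (-1)) (hl i)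
  have hhe : ∀ i t, h i (e t) = e (-1 + 1 / (1 + u i) * (t + 1)) := fun i t => by
    have := (hh i).line e he (-1) rfl t
    rwa [sub_neg_eq_add] at this
  have hlim : ∀ t, Tendsto (fun i => h i (e t)) (hyperfilter ℕ) (𝓝 (e t)) := by
    intro t
    simp_rw [hhe]
    refine Tendsto.mono_left ?_ Nat.hyperfilter_le_atTop
    refine (he.continuous.tendsto t).comp ?_
    have h1 : Tendsto (fun i => -1 + 1 / (1 + u i) * (t + 1)) atTop
        (𝓝 (-1 + 1 / (1 + 0) * (t + 1))) :=
      tendsto_const_nhds.add ((tendsto_const_nhds.div (tendsto_const_nhds.add hulim)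
        (by norm_num)).mul_const _)
    simpa using h1
  obtain ⟨k, hk, hklim⟩ := exists_limit_conf (hyperfilter ℕ) (fun i => (hh i).conf)
    (a := c 0) (a' := c 0) (by simp_rw [(hh _).remote]; exact tendsto_const_nhds)
    (hlim (-1)) (hlim 0) (he.1 _).symm (he.1 _).symm
    (fun h => by have := he.injective h; norm_num at this)
  have hke : ∀ t, k (e t) = e t := fun t => tendsto_nhds_unique (hklim _) (hlim t)
  have hkω : k ω = ω := by rw [← he0, hke]
  have hkc : ∀ t, k (c t) = c t := by
    intro t
    rcases eq_or_ne t 0 with rfl | ht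
    · refine tendsto_nhds_unique (hklim _) ?_
      simp_rw [(hh _).remote]; exact tendsto_const_nhds
    · have h0 := dist_pos.2 (hc.1 0)
      have h1 : c t = e (-(dist (c 0) ω ^ 2)⁻¹ / t) := by
        rw [he_def, relLine_of_ne _ _ _ (by simp [ht, h0.ne'])]
        congr 1
        field_simp
        simp
      rw [h1, hke]
  have hkx : k x ≠ ω := fun h => hx (hk.injective (h.trans hkω.symm))
  have hkrd : ∀ y z, rd ω (k y) (k z) = rd ω y z := by
    obtain ⟨κ, hκ, h1⟩ := hk.exists_factor ω
    rw [hkω] at h1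
    have h2 := h1 (c 0) (c 1)
    rw [hkc, hkc, hc.2] at h2
    norm_num at h2
    intro y z
    rw [h1, ← h2, one_mul]
  have hb1 : bus ω c (k x) = bus ω c x := by
    unfold bus
    congr 1; ext t
    conv_lhs => rw [← hkc t, hkrd]
  have hb2 : bus ω (fun t => c (-t)) (k x) = bus ω (fun t => c (-t)) x := by
    unfold bus
    congr 1; ext t
    change t - rd ω (k x) (c (-t)) = t - rd ω x (c (-t))
    conv_lhs => rw [← hkc (-t), hkrd]
  have hz : ∀ i, bus ω c (h i x) + bus ω (fun t => c (-t)) (h i x) = 0 := by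
    intro i
    have hne : h i x ≠ ω := by
      intro h1
      have h2 : h i (e (u i)) = ω := by
        rw [hhe, ← he0]
        congr 1
        have := hu0 i
        field_simp
        ring
      have h3 := (hh i).conf.injective (h1.trans h2.symm)
      rw [he_def, relLine_of_ne _ _ _ (hu0 i).ne'] at h3
      exact hxc ⟨_, h3.symm⟩
    refine bus_add_reverse_of_differentiableAt hpt hc hne
      (fun h1 => hxo ((hh i).conf.injective (h1.trans (hh i).remote.symm))) ?_
    have h4 : (fun v => rd (c 0) (h i x) (e v)) =
        fun v => 1 / (1 + u i) * g (-1 + (1 + u i) * (v + 1)) := by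
      funext v
      rw [hg]
      simp only
      rw [← (hh i).rd_map, hhe]
      congr 2
      have := hu0 i
      field_simp
      ring
    change DifferentiableAt ℝ (fun v => rd (c 0) (h i x) (e v)) 0
    rw [h4]
    refine DifferentiableAt.const_mul ?_ _
    refine DifferentiableAt.comp (g := g) (f := fun v => -1 + (1 + u i) * (v + 1)) 0
      ?_ (by fun_prop)
    simpa using hud i
  have h5 := (hc.tendsto_bus_of_tendsto hpt hkx (hklim x)).add
    (hc.reverse.tendsto_bus_of_tendsto hpt hkx (hklim x))
  simp_rw [hz] at h5
  have h6 := tendsto_nhds_unique h5 tendsto_const_nhds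
  rw [hb1, hb2] at h6
  linarith

theorem IsLine.bus_concave (hpt : PtolemyIneq X) {ω : X} {w e : ℝ → X} (hw : IsLine ω w)
    (he : IsLine ω e) {a b c : ℝ} (hab : a ≤ b) (hbc : b ≤ c) :
    bus ω w (e a) * (c - b) + bus ω w (e c) * (b - a) ≤ bus ω w (e b) * (c - a) := by
  refine le_of_tendsto_of_tendsto
    (((hw.tendsto_bus hpt (he.1 a)).mul_const _).add ((hw.tendsto_bus hpt (he.1 c)).mul_const _))
    ((hw.tendsto_bus hpt (he.1 b)).mul_const _) (.of_forall fun t => ?_)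
  have := he.rd_convex hpt (hw.1 t) hab hbc
  simp only [rd_comm ω (e _) (w t)]
  linarith

/-- Busemann functions are affine along lines. -/
theorem IsLine.bus_affine [CompactSpace X] (hX : IsNice X) {ω : X} {w e : ℝ → X} (hw : IsLine ω w)
    (he : IsLine ω e) (t : ℝ) :
    bus ω w (e t) = bus ω w (e 0) + t * (bus ω w (e 1) - bus ω w (e 0)) := by
  have key : ∀ a b c : ℝ, a ≤ b → b ≤ c →
      bus ω w (e a) * (c - b) + bus ω w (e c) * (b - a) = bus ω w (e b) * (c - a) := by
    intro a b c hab hbc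
    refine le_antisymm (hw.bus_concave hX.ptolemy he hab hbc) ?_
    have := hw.reverse.bus_concave hX.ptolemy he hab hbc
    simp only [hw.bus_reverse hX (he.1 _)] at this
    linarith
  rcases le_total t 0 with h | h
  · linarith [key t 0 1 h zero_le_one]
  · rcases le_total t 1 with h' | h'
    · linarith [key 0 t 1 h h']
    · linarith [key 0 1 t zero_le_one h']

end

section
open Filter Topology Set
variable {X : Type*} [MetricSpace X]

/-- The unit speed lines which are images of the line `c` under conformal maps fixing `ω`. -/
def orbit (ω : X) (c : ℝ → X) : Set (ℝ → X) :=
  {e | IsLine ω e ∧ ∃ g : X → X, IsConf g ∧ g ω = ω ∧ ∀ t, e t = g (c t)}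

theorem IsLine.mem_orbit {ω : X} {c : ℝ → X} (hc : IsLine ω c) : c ∈ orbit ω c :=
  ⟨hc, _, isConf_id, rfl, fun _ => rfl⟩

/-- The slope of the Busemann function of `w` along `e`. -/
noncomputable def busSlope (ω : X) (w e : ℝ → X) : ℝ := bus ω w (e 1) - bus ω w (e 0)

theorem busSlope_le_one (hpt : PtolemyIneq X) {ω : X} {w e : ℝ → X} (hw : IsLine ω w)
    (he : IsLine ω e) : busSlope ω w e ≤ 1 := by
  have := hw.bus_sub_le hpt (he.1 1) (he.1 0)
  rw [he.2] at this
  norm_num at this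
  unfold busSlope
  linarith

variable [CompactSpace X]

theorem orbit_map (hX : IsNice X) {ω : X} {c e : ℝ → X} (hc : IsLine ω c) (he : e ∈ orbit ω c)
    {f : X → X} (hf : IsConf f) (hfω : f ω = ω) {κ : ℝ} (hκ : 0 < κ)
    (h : ∀ x y, rd ω (f x) (f y) = κ * rd ω x y) : (fun t => f (e (t / κ))) ∈ orbit ω c := by
  obtain ⟨he, g, hg, hgω, heg⟩ := he
  have h1 := he.map hf hκ (by rw [hfω]; exact h)
  rw [hfω] at h1
  obtain ⟨k, hk⟩ := hX.exists_hom (hc.1 0) (inv_pos.2 hκ)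
  refine ⟨h1, _, hf.comp (hg.comp hk.conf), by rw [hk.remote, hgω, hfω], fun t => ?_⟩
  rw [hk.line c hc 0 rfl]
  change f (e (t / κ)) = _
  rw [heg]
  congr 3
  rw [div_eq_inv_mul]
  ring

theorem orbit_shift (hX : IsNice X) {ω : X} {c e : ℝ → X} (hc : IsLine ω c) (he : e ∈ orbit ω c)
    (b : ℝ) : (fun t => e (t + b)) ∈ orbit ω c := by
  obtain ⟨he, g, hg, hgω, heg⟩ := he
  obtain ⟨k, hk⟩ := hX.exists_hom (hc.1 0) two_pos
  obtain ⟨k', hk'⟩ := hX.exists_hom (hc.1 (2 * b)) (half_pos one_pos)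
  refine ⟨he.shift b, _, hg.comp (hk'.conf.comp hk.conf), by rw [hk.remote, hk'.remote, hgω],
    fun t => ?_⟩
  rw [hk.line c hc 0 rfl, hk'.line c hc _ rfl]
  change e (t + b) = _
  rw [heg]
  congr 2
  ring

theorem orbit_limit {ω p : X} {c : ℝ → X} {ι : Type*} (U : Ultrafilter ι) (hp : p ≠ ω)
    {e : ι → ℝ → X} (he : ∀ i, e i ∈ orbit ω c) (h : Tendsto (fun i => e i 0) U (𝓝 p)) :
    ∃ e' ∈ orbit ω c, e' 0 = p ∧ ∀ t, Tendsto (fun i => e i t) U (𝓝 (e' t)) := by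
  choose hl g hg hgω heg using he
  obtain ⟨e', he', he0, hlim⟩ := exists_limit_line U hp hl h
  have hlim' := hlim
  simp_rw [heg] at hlim'
  obtain ⟨g', hg', hlim''⟩ := exists_limit_conf U hg (a := ω) (a' := ω)
    (by simp_rw [hgω]; exact tendsto_const_nhds) (hlim' 0) (hlim' 1) (he'.1 0).symm (he'.1 1).symm
    (fun h => zero_ne_one (he'.injective h))
  refine ⟨e', ⟨he', g', hg', ?_, fun t => tendsto_nhds_unique (hlim' t) (hlim'' _)⟩, he0, hlim⟩
  refine tendsto_nhds_unique (hlim'' ω) ?_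
  simp_rw [hgω]; exact tendsto_const_nhds

theorem IsLine.bus_eq (hX : IsNice X) {ω : X} {w e : ℝ → X} (hw : IsLine ω w)
    (he : IsLine ω e) (t : ℝ) : bus ω w (e t) = bus ω w (e 0) + t * busSlope ω w e :=
  hw.bus_affine hX he t

/-- The maximal slope of a Busemann function on an orbit is attained by a line through a given
point. -/
theorem exists_max_busSlope (hX : IsNice X) {ω : X} {c w : ℝ → X} (hc : IsLine ω c)
    (hw : IsLine ω w) :
    ∃ e ∈ orbit ω c, e 0 = w 0 ∧ ∀ e' ∈ orbit ω c, busSlope ω w e' ≤ busSlope ω w e := by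
  have hpt := hX.ptolemy
  have hbdd : BddAbove (busSlope ω w '' orbit ω c) :=
    ⟨1, by rintro _ ⟨e, he, rfl⟩; exact busSlope_le_one hpt hw he.1⟩
  have hne : (busSlope ω w '' orbit ω c).Nonempty := ⟨_, c, hc.mem_orbit, rfl⟩
  set A := sSup (busSlope ω w '' orbit ω c)
  have hlim0 : Tendsto (fun i : ℕ => 1 / ((i : ℝ) + 1)) (hyperfilter ℕ) (𝓝 0) :=
    tendsto_one_div_add_atTop_nhds_zero_nat.mono_left Nat.hyperfilter_le_atTop
  have hex : ∀ i : ℕ, ∃ e ∈ orbit ω c, A - 1 / ((i : ℝ) + 1) < busSlope ω w e := by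
    intro i
    have h0 : (0 : ℝ) < 1 / ((i : ℝ) + 1) := by positivity
    obtain ⟨_, ⟨e, he, rfl⟩, h⟩ := exists_lt_of_lt_csSup hne
      (show A - 1 / ((i : ℝ) + 1) < A by linarith)
    exact ⟨e, he, h⟩
  choose e he hes using hex
  have hl : ∀ i : ℕ, 0 < 1 / ((i : ℝ) + 1) / (1 + rd ω (e i 0) (w 0)) := fun i => by
    have := rd_nonneg ω (e i 0) (w 0)
    positivity
  choose h hh using fun i => hX.exists_hom (hw.1 0) (hl i)
  set l := fun i : ℕ => 1 / ((i : ℝ) + 1) / (1 + rd ω (e i 0) (w 0)) with hl_def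
  have hmem : ∀ i, (fun t => h i (e i (t / l i))) ∈ orbit ω c := fun i =>
    orbit_map hX hc (he i) (hh i).conf (hh i).remote (hl i) (hh i).rd_map
  have hsl : ∀ i, busSlope ω w (fun t => h i (e i (t / l i))) = busSlope ω w (e i) := by
    intro i
    have h0 : 0 < l i := hl i
    rw [busSlope, hw.bus_hom hpt (hl i) (hh i) ((he i).1.1 _),
      hw.bus_hom hpt (hl i) (hh i) ((he i).1.1 _), hw.bus_eq hX (he i).1 (1 / l i), zero_div]
    change l i * _ - l i * _ = _
    field_simp
    ring
  obtain ⟨e', he', he0, hlim⟩ := orbit_limit (hyperfilter ℕ) (hw.1 0) hmem (by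
    refine tendsto_of_rd (hw.1 0) (fun i => (hmem i).1.1 0) ?_
    refine squeeze_zero (fun i => rd_nonneg _ _ _) (fun i => ?_) hlim0
    have h1 : rd ω (h i (e i (0 / l i))) (w 0) = l i * rd ω (e i 0) (w 0) := by
      conv_lhs => rw [← (hh i).center, (hh i).rd_map, zero_div]
    rw [h1, hl_def]
    have := rd_nonneg ω (e i 0) (w 0)
    simp only
    rw [div_mul_eq_mul_div, div_le_iff₀ (by positivity)]
    gcongr
    linarith)
  refine ⟨e', he', he0, fun e'' he'' => ?_⟩
  have h1 : busSlope ω w e'' ≤ A := le_csSup hbdd ⟨_, he'', rfl⟩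
  refine h1.trans ?_
  have h2 := (hw.tendsto_bus_of_tendsto hpt (he'.1.1 1) (hlim 1)).sub
    (hw.tendsto_bus_of_tendsto hpt (he'.1.1 0) (hlim 0))
  have h3 : Tendsto (fun i : ℕ => A - 1 / ((i : ℝ) + 1)) (hyperfilter ℕ) (𝓝 (A - 0)) :=
    hlim0.const_sub A
  rw [sub_zero] at h3
  refine le_of_tendsto_of_tendsto h3 h2 (.of_forall fun i => ?_)
  have h4 := (hes i).le
  rw [← hsl] at h4
  exact h4

/-- The upper bound for the derivative of a Busemann function along an inverted line. -/
theorem frequently_slope_lt (hX : IsNice X) {ω : X} {c w e : ℝ → X} (hc : IsLine ω c)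
    (hw : IsLine ω w) (he : e ∈ orbit ω c) (hy : w 0 ∉ range e) {φ : X → X}
    (hφ : IsInv ω (w 0) 1 φ) {A : ℝ} (hA : ∀ e' ∈ orbit ω c, busSlope ω w e' ≤ A) {t r : ℝ}
    (hr : A / rd ω (e t) (w 0) ^ 2 < r) :
    ∃ᶠ z in 𝓝[>] t, slope (fun s => bus ω w (φ (e s))) t z < r := by
  have hpt := hX.ptolemy
  have hl := he.1
  have hey : ∀ s, e s ≠ w 0 := fun s h => hy ⟨s, h⟩
  set ρ : ℝ → ℝ := fun s => rd ω (e s) (w 0) with hρ_def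
  have hρ0 : ∀ s, 0 < ρ s := fun s => rd_pos (hl.1 s) (hw.1 0) (hey s)
  have hρc : Tendsto ρ (𝓝 t) (𝓝 (ρ t)) :=
    tendsto_rd (hl.continuous.tendsto t) tendsto_const_nhds (hl.1 t) (hw.1 0)
  have hφω : ∀ x, x ≠ w 0 → φ x ≠ ω := fun x hx h =>
    hx (hφ.conf.injective (h.trans hφ.center.symm))
  have hb : φ (e t) ≠ ω := hφω _ (hey t)
  set b := φ (e t)
  have hyb : w 0 ≠ b := fun h => hl.1 t (hφ.conf.injective (h.symm.trans hφ.remote.symm))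
  have hl0 : ∀ i : ℕ, (0 : ℝ) < (i : ℝ) + 1 := fun i => by positivity
  choose h hh using fun i => hX.exists_hom hb (hl0 i)
  choose k hk using fun i => hX.exists_hom (hl.1 t) (inv_pos.2 (hl0 i))
  have hke : ∀ i, k i (e (t + 1)) = e (t + ((i : ℝ) + 1)⁻¹) := fun i => by
    rw [(hk i).line e hl t rfl]; congr 1; ring
  have hinv0 : Tendsto (fun i : ℕ => ((i : ℝ) + 1)⁻¹) (hyperfilter ℕ) (𝓝 0) := by
    simp_rw [← one_div]
    exact tendsto_one_div_add_atTop_nhds_zero_nat.mono_left Nat.hyperfilter_le_atTop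
  have htop : Tendsto (fun i : ℕ => (i : ℝ) + 1) (hyperfilter ℕ) atTop :=
    (tendsto_atTop_add_const_right _ _ tendsto_natCast_atTop_atTop).mono_left
      Nat.hyperfilter_le_atTop
  have hzt : Tendsto (fun i : ℕ => t + ((i : ℝ) + 1)⁻¹) (hyperfilter ℕ) (𝓝 t) := by
    simpa using hinv0.const_add t
  have hhω : ∀ i x, x ≠ ω → h i x ≠ ω := fun i x hx h' =>
    hx ((hh i).conf.injective (h'.trans (hh i).remote.symm))
  have lim1 : Tendsto (fun i => h i (φ (k i ω))) (hyperfilter ℕ) (𝓝 ω) := by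
    simp_rw [(hk _).remote, hφ.remote]
    refine tendsto_remote_of_rd hb (fun i => hhω i _ (hw.1 0)) ?_
    have : ∀ i, rd ω (h i (w 0)) b = ((i : ℝ) + 1) * rd ω (w 0) b := fun i => by
      conv_lhs => rw [← (hh i).center, (hh i).rd_map]
    simp_rw [this]
    exact htop.atTop_mul_const (rd_pos (hw.1 0) hb hyb)
  have lim2 : Tendsto (fun i => h i (φ (k i (e t)))) (hyperfilter ℕ) (𝓝 b) := by
    simp_rw [(hk _).center]
    change Tendsto (fun i => h i b) _ _
    simp_rw [(hh _).center]
    exact tendsto_const_nhds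
  obtain ⟨p, hp⟩ := exists_tendsto (hyperfilter ℕ) fun i => h i (φ (k i (e (t + 1))))
  have hrd : ∀ i, rd ω (h i (φ (k i (e (t + 1))))) b = 1 / (ρ (t + ((i : ℝ) + 1)⁻¹) * ρ t) := by
    intro i
    have h1 : rd ω (h i (φ (k i (e (t + 1))))) b =
        ((i : ℝ) + 1) * rd ω (φ (e (t + ((i : ℝ) + 1)⁻¹))) b := by
      conv_lhs => rw [← (hh i).center, (hh i).rd_map, hke]
    have := hl0 i
    rw [h1, hφ.rd_map _ _ (hl.1 _) (hey _) (hl.1 _) (hey _), hl.2, add_sub_cancel_left,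
      abs_of_pos (inv_pos.2 (hl0 i))]
    field_simp
    simp [hρ_def]
  obtain ⟨hpω, hpb⟩ := ne_of_tendsto_rd (g := fun _ => b) (p := b) (r := 1 / (ρ t * ρ t))
    (fun i => hhω i _ (by rw [hke]; exact hφω _ (hey _))) (fun _ => hb) hb tendsto_const_nhds hp (by
      simp_rw [hrd]
      have := hρ0 t
      exact tendsto_const_nhds.div ((hρc.comp hzt).mul_const _) (by positivity))
  have hpb' : p ≠ b := by
    rintro rfl
    rw [rd_self] at hpb
    have := hρ0 t
    have : 0 < 1 / (ρ t * ρ t) := by positivity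
    linarith
  obtain ⟨G, hG, hGlim⟩ := exists_limit_conf (hyperfilter ℕ)
    (fun i => (hh i).conf.comp (hφ.conf.comp (hk i).conf)) lim1 lim2 hp hb.symm hpω.symm hpb'.symm
  have hGω : G ω = ω := tendsto_nhds_unique (hGlim _) lim1
  have hGb : G (e t) = b := tendsto_nhds_unique (hGlim _) lim2
  have hGp : G (e (t + 1)) = p := tendsto_nhds_unique (hGlim _) hp
  obtain ⟨κ, hκ0, hκ⟩ := hG.exists_factor ω
  rw [hGω] at hκ
  have hκρ : κ = 1 / ρ t ^ 2 := by
    have h1 := hκ (e (t + 1)) (e t)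
    rw [hGb, hGp, hpb, hl.2] at h1
    norm_num at h1
    rw [← h1]
    field_simp
  have hn := orbit_map hX hc (orbit_shift hX hc he t) hG hGω hκ0 hκ
  set n : ℝ → X := fun u => G (e (u / κ + t)) with hn_def
  have hn0 : n 0 = b := by rw [hn_def]; simpa using hGb
  have hnκ : n κ = p := by rw [hn_def]; simp only [div_self hκ0.ne']; rw [add_comm, hGp]
  have hhn : ∀ i, h i (n (κ * ((i : ℝ) + 1)⁻¹)) = p := fun i => by
    have := hl0 i
    rw [(hh i).line n hn.1 0 hn0, ← hnκ]
    congr 1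
    field_simp
    ring
  have hsmall : Tendsto (fun i : ℕ => ((i : ℝ) + 1) * rd ω (φ (e (t + ((i : ℝ) + 1)⁻¹)))
      (n (κ * ((i : ℝ) + 1)⁻¹))) (hyperfilter ℕ) (𝓝 0) := by
    have h1 := tendsto_rd hp tendsto_const_nhds hpω hpω
    rw [rd_self] at h1
    refine h1.congr fun i => ?_
    rw [← (hh i).rd_map, hhn, hke]
  have hκA : κ * busSlope ω w n < r := by
    refine lt_of_le_of_lt ?_ hr
    rw [hκρ, one_div, inv_mul_eq_div]
    gcongr
    exact hA n hn
  have hev : ∀ᶠ i : ℕ in (hyperfilter ℕ : Filter ℕ),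
      slope (fun s => bus ω w (φ (e s))) t (t + ((i : ℝ) + 1)⁻¹) < r := by
    filter_upwards [hsmall.eventually_lt_const
      (show 0 < r - κ * busSlope ω w n by linarith)] with i hi
    have h0 := hl0 i
    have h1 := hw.bus_sub_le hpt (hφω _ (hey (t + ((i : ℝ) + 1)⁻¹))) (hn.1.1 (κ * ((i : ℝ) + 1)⁻¹))
    rw [hw.bus_eq hX hn.1, hn0] at h1
    rw [slope_def_field, add_sub_cancel_left, div_inv_eq_mul]
    have h2 := mul_le_mul_of_nonneg_left h1 h0.le
    have h3 : ((i : ℝ) + 1) * (κ * ((i : ℝ) + 1)⁻¹ * busSlope ω w n) = κ * busSlope ω w n := by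
      field_simp
    change (bus ω w (φ (e (t + ((i : ℝ) + 1)⁻¹))) - bus ω w b) * _ < r
    nlinarith
  refine Tendsto.frequently (f := fun i : ℕ => t + ((i : ℝ) + 1)⁻¹)
    (l₁ := (hyperfilter ℕ : Filter ℕ)) ?_
    hev.frequently
  refine tendsto_nhdsWithin_iff.2 ⟨hzt, .of_forall fun i => ?_⟩
  have := inv_pos.2 (hl0 i)
  simp only [mem_Ioi]
  linarith

end

section
open Filter Topology Set
variable {X : Type*} [MetricSpace X]

theorem IsLine.rd_bound (hpt : PtolemyIneq X) {ω : X} {e : ℝ → X} (he : IsLine ω e) {y : X}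
    (hy : y ≠ ω) (t : ℝ) : |t| - rd ω (e 0) y ≤ rd ω (e t) y := by
  have h := rd_triangle hpt (he.1 0) hy (he.1 t)
  rw [he.2, zero_sub, abs_neg, rd_comm ω y] at h
  linarith

/-- An upper bound for the Busemann function after inversion, by convexity. -/
theorem bus_inv_mul_le (hX : IsNice X) {ω : X} {w : ℝ → X} {φ : X → X} (hw : IsLine ω w)
    (hφ : IsInv ω (w 0) 1 φ) {q : X} (hq : q ≠ ω) (hq0 : q ≠ w 0) :
    bus ω w (φ q) * rd ω q (w 0) ≤ 2 * (rd ω q (w (1 / 2)) - rd ω q (w 0)) := by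
  have hφω : φ q ≠ ω := fun h => hq0 (hφ.conf.injective (h.trans hφ.center.symm))
  have hp := rd_pos hq (hw.1 0) hq0
  refine le_of_tendsto ((hw.tendsto_bus hX.ptolemy hφω).mul_const _) ?_
  filter_upwards [eventually_gt_atTop 0] with τ hτ
  have hne : -1 / τ ≠ 0 := div_ne_zero (by norm_num) hτ.ne'
  have h1 := hφ.line w hw rfl _ hne
  rw [show -(1 ^ 2) / (-1 / τ) = τ by field_simp] at h1
  rw [← h1, hφ.rd_map _ _ hq hq0 (hw.1 _) (fun h => hne (hw.injective h)), hw.2, sub_zero, abs_div,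
    abs_neg, abs_one, abs_of_pos hτ]
  have h2 := hw.rd_convex hX.ptolemy hq (a := -1 / τ) (b := 0) (c := 1 / 2)
    (by rw [neg_div]; exact neg_nonpos.2 (by positivity)) (by norm_num)
  have h3 : (τ - 1 ^ 2 * rd ω q (w (-1 / τ)) / (rd ω q (w 0) * (1 / τ))) * rd ω q (w 0) =
      τ * (rd ω q (w 0) - rd ω q (w (-1 / τ))) := by
    field_simp
  rw [h3]
  have h4 := mul_le_mul_of_nonneg_left h2 (mul_nonneg zero_le_two hτ.le)
  have h5 : τ * (-1 / τ) = -1 := by field_simp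
  have h6 : 2 * τ * (rd ω q (w 0) * (1 / 2 - -1 / τ)) =
      rd ω q (w 0) * (τ - 2 * (τ * (-1 / τ))) := by ring
  have h7 : 2 * τ * (rd ω q (w (-1 / τ)) * (1 / 2 - 0) + rd ω q (w (1 / 2)) * (0 - -1 / τ)) =
      rd ω q (w (-1 / τ)) * τ - 2 * (τ * (-1 / τ)) * rd ω q (w (1 / 2)) := by ring
  rw [h6, h7, h5] at h4
  linarith

variable [CompactSpace X]

theorem exists_orbit_notMem (hX : IsNice X) {ω x y : X} {c : ℝ → X} (hc : IsLine ω c)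
    (hx : x ≠ ω) (hxc : x ∉ range c) : ∃ e ∈ orbit ω c, y ∉ range e := by
  by_contra! hcon
  have hl0 : ∀ i : ℕ, (0 : ℝ) < (i : ℝ) + 1 := fun i => by positivity
  choose h hh using fun i => hX.exists_hom hx (hl0 i)
  have hs : ∀ i : ℕ, ∃ s, y = h i (c s) := fun i => by
    obtain ⟨t, ht⟩ := hcon _ (orbit_map hX hc hc.mem_orbit (hh i).conf (hh i).remote (hl0 i)
      (hh i).rd_map)
    exact ⟨_, ht.symm⟩
  choose s hs using hs
  have hrd : ∀ i, rd ω (c (s i)) x = 1 / ((i : ℝ) + 1) * rd ω y x := by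
    intro i
    have h1 := (hh i).rd_map (c (s i)) x
    rw [← hs, (hh i).center] at h1
    have := hl0 i
    rw [h1]
    field_simp
  have hlim : Tendsto (fun i => rd ω (c (s i)) x) (hyperfilter ℕ) (𝓝 0) := by
    simp_rw [hrd]
    refine Tendsto.mono_left ?_ Nat.hyperfilter_le_atTop
    simpa using tendsto_one_div_add_atTop_nhds_zero_nat.mul_const (rd ω y x)
  have hbd : ∀ i, s i ∈ Icc (-(rd ω y x + rd ω (c 0) x)) (rd ω y x + rd ω (c 0) x) := by
    intro i
    have h1 := hc.rd_bound hX.ptolemy hx (s i)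
    have h2 : rd ω (c (s i)) x ≤ rd ω y x := by
      rw [hrd]
      refine mul_le_of_le_one_left (rd_nonneg _ _ _) ?_
      rw [div_le_one (hl0 i)]
      have : (0 : ℝ) ≤ i := Nat.cast_nonneg i
      linarith
    exact abs_le.1 (by linarith)
  obtain ⟨t, -, ht⟩ := isCompact_Icc.ultrafilter_le_nhds ((hyperfilter ℕ).map s)
    (by rw [Ultrafilter.coe_map, le_principal_iff]; exact mem_map.2 (univ_mem' hbd))
  have ht' : Tendsto s (hyperfilter ℕ) (𝓝 t) := ht
  have h1 := tendsto_rd ((hc.continuous.tendsto t).comp ht') tendsto_const_nhds (hc.1 t) hx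
  exact hxc ⟨t, eq_of_rd_eq_zero (hc.1 t) hx (tendsto_nhds_unique h1 hlim)⟩

section
variable {ω : X} {c w e : ℝ → X} {φ : X → X} {A : ℝ}

theorem continuous_bus_inv (hX : IsNice X) (hw : IsLine ω w) (he : IsLine ω e)
    (hy : w 0 ∉ range e) (hφ : IsInv ω (w 0) 1 φ) :
    Continuous fun s => bus ω w (φ (e s)) := by
  have hey : ∀ s, e s ≠ w 0 := fun s h => hy ⟨s, h⟩
  have hφω : ∀ x, x ≠ w 0 → φ x ≠ ω := fun x hx h =>
    hx (hφ.conf.injective (h.trans hφ.center.symm))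
  rw [continuous_iff_continuousAt]
  intro t
  refine hw.tendsto_bus_of_tendsto hX.ptolemy (hφω _ (hey t)) ?_
  refine tendsto_of_rd (hφω _ (hey t)) (fun s => hφω _ (hey s)) ?_
  have h1 : ∀ s, rd ω (φ (e s)) (φ (e t)) =
      1 ^ 2 * |s - t| / (rd ω (e s) (w 0) * rd ω (e t) (w 0)) := fun s => by
    rw [hφ.rd_map _ _ (he.1 _) (hey _) (he.1 _) (hey _), he.2]
  simp_rw [h1]
  have h2 : Tendsto (fun s => rd ω (e s) (w 0)) (𝓝 t) (𝓝 (rd ω (e t) (w 0))) :=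
    tendsto_rd (he.continuous.tendsto t) tendsto_const_nhds (he.1 t) (hw.1 0)
  have h3 : Tendsto (fun s : ℝ => 1 ^ 2 * |s - t|) (𝓝 t) (𝓝 (1 ^ 2 * |t - t|)) :=
    Continuous.tendsto (by fun_prop) t
  have h4 := rd_pos (he.1 t) (hw.1 0) (hey t)
  have h5 := h3.div (h2.mul_const (rd ω (e t) (w 0))) (by positivity)
  simp only [sub_self, abs_zero, mul_zero, zero_div] at h5
  exact h5

theorem tendsto_bus_inv (hX : IsNice X) (hw : IsLine ω w) (he : IsLine ω e)
    (hy : w 0 ∉ range e) (hφ : IsInv ω (w 0) 1 φ) {l : Filter ℝ}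
    (hl : Tendsto (fun t : ℝ => |t|) l atTop) :
    Tendsto (fun s => bus ω w (φ (e s))) l (𝓝 0) := by
  have hey : ∀ s, e s ≠ w 0 := fun s h => hy ⟨s, h⟩
  have hφω : ∀ x, x ≠ w 0 → φ x ≠ ω := fun x hx h =>
    hx (hφ.conf.injective (h.trans hφ.center.symm))
  have h0 : Tendsto (fun t => φ (e t)) l (𝓝 (w 0)) := by
    refine tendsto_of_rd (hw.1 0) (fun s => hφω _ (hey s)) ?_
    simp_rw [fun s => hφ.rd_center _ (he.1 s) (hey s)]
    refine tendsto_const_nhds.div_atTop ?_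
    exact tendsto_atTop_mono (he.rd_bound hX.ptolemy (hw.1 0))
      (tendsto_atTop_add_const_right _ (-rd ω (e 0) (w 0)) hl)
  have h1 := hw.tendsto_bus_of_tendsto hX.ptolemy (hw.1 0) h0
  rwa [hw.bus_apply hX.ptolemy] at h1

theorem max_busSlope_nonneg (hX : IsNice X) (hc : IsLine ω c) (hw : IsLine ω w)
    (he : e ∈ orbit ω c) (hy : w 0 ∉ range e) (hφ : IsInv ω (w 0) 1 φ)
    (hA : ∀ e' ∈ orbit ω c, busSlope ω w e' ≤ A) : 0 ≤ A := by
  by_contra! hneg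
  set P : ℝ → ℝ := fun s => bus ω w (φ (e s)) with hP
  have hcont : Continuous P := continuous_bus_inv hX hw he.1 hy hφ
  have hfr := fun t r => frequently_slope_lt hX hc hw he hy hφ hA (t := t) (r := r)
  have hρ0 : ∀ s, 0 < rd ω (e s) (w 0) := fun s =>
    rd_pos (he.1.1 s) (hw.1 0) fun h => hy ⟨s, h⟩
  have hanti : ∀ a b, a ≤ b → P b ≤ P a := by
    intro a b hab
    refine image_le_of_liminf_slope_right_le_deriv_boundary (a := a) (b := b) (B := fun _ => P a)
      (B' := fun _ => 0) hcont.continuousOn le_rfl continuousOn_const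
      (fun x _ => hasDerivWithinAt_const _ _ _) (fun x _ r hr => hfr x r ?_) (right_mem_Icc.2 hab)
    have := hρ0 x
    have : A / rd ω (e x) (w 0) ^ 2 < 0 := div_neg_of_neg_of_pos hneg (by positivity)
    linarith
  set M := rd ω (e 0) (w 0) + 1 with hM
  have hM0 : 0 < M := by have := hρ0 0; linarith
  have hstrict : P 1 ≤ P 0 + A / M ^ 2 * 1 := by
    refine image_le_of_liminf_slope_right_le_deriv_boundary (a := 0) (b := 1)
      (B := fun x => P 0 + A / M ^ 2 * x)
      (B' := fun _ => A / M ^ 2) hcont.continuousOn (by simp) (by fun_prop)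
      (fun x _ => ?_) (fun x hx r hr => hfr x r ?_) (right_mem_Icc.2 zero_le_one)
    · simpa using (((hasDerivAt_id x).const_mul (A / M ^ 2)).const_add (P 0)).hasDerivWithinAt
    · refine lt_of_le_of_lt ?_ hr
      have h1 := rd_triangle hX.ptolemy (he.1.1 x) (he.1.1 0) (hw.1 0)
      rw [he.1.2, sub_zero, abs_of_nonneg hx.1] at h1
      have h2 : rd ω (e x) (w 0) ≤ M := by have := hx.2; linarith
      have h3 := hρ0 x
      rw [div_le_div_iff₀ (by positivity) (by positivity)]
      have : rd ω (e x) (w 0) ^ 2 ≤ M ^ 2 := by gcongr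
      nlinarith
  have h0 : P 0 ≤ 0 := ge_of_tendsto (tendsto_bus_inv hX hw he.1 hy hφ tendsto_abs_atBot_atTop)
    ((eventually_le_atBot 0).mono fun t ht => hanti t 0 ht)
  have h1 : 0 ≤ P 1 := le_of_tendsto (tendsto_bus_inv hX hw he.1 hy hφ tendsto_abs_atTop_atTop)
    ((eventually_ge_atTop 1).mono fun t ht => hanti 1 t ht)
  have : A / M ^ 2 < 0 := div_neg_of_neg_of_pos hneg (by positivity)
  linarith

theorem neg_bus_inv_mul_le (hX : IsNice X) (hc : IsLine ω c) (hw : IsLine ω w)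
    (he : e ∈ orbit ω c) (hy : w 0 ∉ range e) (hφ : IsInv ω (w 0) 1 φ)
    (hA : ∀ e' ∈ orbit ω c, busSlope ω w e' ≤ A) (hA0 : 0 ≤ A) {t₀ t : ℝ}
    (ht₀ : bus ω e (w 0) = t₀) (ht : t₀ < t) : -bus ω w (φ (e t)) * (t - t₀) ≤ A := by
  set P : ℝ → ℝ := fun s => bus ω w (φ (e s)) with hP
  have hcont : Continuous P := continuous_bus_inv hX hw he.1 hy hφ
  have hfr := fun t r => frequently_slope_lt hX hc hw he hy hφ hA (t := t) (r := r)
  have hρ : ∀ s, s - t₀ ≤ rd ω (e s) (w 0) := fun s => by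
    have := he.1.le_bus hX.ptolemy (hw.1 0) s
    rw [rd_comm ω (e s)]
    linarith
  have key : ∀ T, t ≤ T → P T ≤ P t + A / (t - t₀) - A / (T - t₀) := by
    intro T hT
    have hne : ∀ x ∈ Icc t T, x - t₀ ≠ 0 := fun x hx => by have := hx.1; linarith
    have hder : ∀ x ∈ Icc t T, HasDerivAt (fun x => P t + A / (t - t₀) - A / (x - t₀))
        (A / (x - t₀) ^ 2) x := by
      intro x hx
      have h1 := ((((hasDerivAt_id x).sub_const t₀).inv (hne x hx)).const_mul A).const_sub
        (P t + A / (t - t₀))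
      refine (h1.congr_deriv ?_).congr_of_eventuallyEq (Eventually.of_forall fun y => ?_)
      · simp only [id]
        ring
      · simp [div_eq_mul_inv]
    refine image_le_of_liminf_slope_right_le_deriv_boundary (a := t) (b := T)
      (B' := fun x => A / (x - t₀) ^ 2)
      (B := fun x => P t + A / (t - t₀) - A / (x - t₀)) hcont.continuousOn (by simp)
      (fun x hx => (hder x hx).continuousAt.continuousWithinAt)
      (fun x hx => (hder x ⟨hx.1, hx.2.le⟩).hasDerivWithinAt)
      (fun x hx r hr => hfr x r ?_) (right_mem_Icc.2 hT)
    refine lt_of_le_of_lt ?_ hr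
    have h1 := hρ x
    have h2 : 0 < x - t₀ := by have := hx.1; linarith
    gcongr
  have h1 : Tendsto (fun T => P t + A / (t - t₀) - A / (T - t₀)) atTop
      (𝓝 (P t + A / (t - t₀) - 0)) :=
    (tendsto_const_nhds.div_atTop (tendsto_atTop_add_const_right _ (-t₀) tendsto_id)).const_sub _
  have h2 := le_of_tendsto_of_tendsto
    (tendsto_bus_inv hX hw he.1 hy hφ tendsto_abs_atTop_atTop) h1
    ((eventually_ge_atTop t).mono key)
  rw [sub_zero] at h2
  have h3 : 0 < t - t₀ := by linarith
  have h4 : A / (t - t₀) * (t - t₀) = A := by field_simp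
  change -P t * (t - t₀) ≤ A
  nlinarith

end

/-- The maximal slope equals one. -/
theorem max_busSlope_eq_one (hX : IsNice X) {ω x : X} {c w e : ℝ → X} (hc : IsLine ω c)
    (hw : IsLine ω w) (hx : x ≠ ω) (hxc : x ∉ range c) (he : e ∈ orbit ω c) (h0 : e 0 = w 0)
    (hA : ∀ e' ∈ orbit ω c, busSlope ω w e' ≤ busSlope ω w e) : busSlope ω w e = 1 := by
  have hpt := hX.ptolemy
  have hl := he.1
  set A := busSlope ω w e with hA_def
  have hA1 : A ≤ 1 := busSlope_le_one hpt hw hl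
  have hbus : ∀ t, bus ω w (e t) = t * A := fun t => by
    rw [hw.bus_eq hX hl, h0, hw.bus_apply hpt, zero_add]
  have hA0 : 0 ≤ A := by
    obtain ⟨e', he', hy⟩ := exists_orbit_notMem hX hc hx hxc (y := w 0)
    obtain ⟨φ, hφ⟩ := hX.exists_inv (hw.1 0) one_pos
    exact max_busSlope_nonneg hX hc hw he' hy hφ hA
  by_contra hne
  have hlt : A < 1 := lt_of_le_of_ne hA1 hne
  set F : ℝ → ℝ → ℝ := fun u v => rd ω (e u) (w v) with hF
  have hhom : ∀ l u v, 0 < l → F (l * u) (l * v) = l * F u v := by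
    intro l u v hl0
    obtain ⟨h, hh⟩ := hX.exists_hom (hw.1 0) hl0
    have h1 := hh.line e hl 0 h0 u
    have h2 := hh.line w hw 0 rfl v
    simp only [zero_add, sub_zero] at h1 h2
    simp only [hF]
    rw [← h1, ← h2, hh.rd_map]
  have hy : w (-1) ∉ range e := by
    rintro ⟨t, ht⟩
    have h1 := hl.2 t 0
    rw [ht, h0, hw.2, sub_zero, sub_zero, abs_neg, abs_one] at h1
    have h2 := hbus t
    rw [ht, hw.bus_apply hpt] at h2
    rcases abs_eq_abs.1 (h1.symm.trans abs_one.symm) with rfl | rfl <;> linarith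
  have hv := hw.shift (-1)
  set v : ℝ → X := fun t => w (t + -1) with hv_def
  have hv0 : v 0 = w (-1) := by simp [hv_def]
  have hAv : ∀ e' ∈ orbit ω c, busSlope ω v e' ≤ A := by
    intro e' he'
    have h1 := hA e' he'
    unfold busSlope at h1 ⊢
    rw [hw.bus_shift hpt (he'.1.1 _), hw.bus_shift hpt (he'.1.1 _)]
    linarith
  have hsym : ∀ u, 0 < u → F u (-1) = F (-1) u := by
    intro u hu
    obtain ⟨φ, hφ⟩ := hX.exists_inv (hw.1 0) one_pos
    have h1 := hφ.line e hl h0 u hu.ne'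
    have h2 := hφ.line w hw rfl (-1) (by norm_num)
    have h3 := hφ.rd_map (e u) (w (-1)) (hl.1 _)
      (fun h => hu.ne' (hl.injective (h.trans h0.symm))) (hw.1 _)
      (fun h => by have := hw.injective h; norm_num at this)
    rw [h1, h2, ← h0, hl.2, h0, hw.2, sub_zero, abs_of_pos hu] at h3
    norm_num at h3
    have h4 := hhom u (-1 / u) 1 hu
    rw [show u * (-1 / u) = -1 by field_simp, mul_one] at h4
    rw [h4]
    simp only [hF]
    rw [h3]
    field_simp
  have ht₀ : bus ω e (v 0) = -A := by
    rw [hv0]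
    have h1 := hw.tendsto_bus hpt (hl.1 (-1))
    rw [hbus] at h1
    have h2 := hl.tendsto_bus hpt (hw.1 (-1))
    rw [show -A = -1 * A by ring]
    refine tendsto_nhds_unique h2 (h1.congr' ?_)
    filter_upwards [eventually_gt_atTop 0] with u hu
    rw [rd_comm ω (w (-1))]
    have := hsym u hu
    simp only [hF] at this
    rw [this]
  obtain ⟨φ, hφ⟩ := hX.exists_inv (hv.1 0) one_pos
  set θ : ℝ → ℝ := fun ε => F 1 (-(1 / ε)) - 1 / ε with hθ
  have hθlim : Tendsto θ (𝓝[>] 0) (𝓝 A) := by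
    have h1 := hw.reverse.tendsto_bus hpt (hl.1 1)
    rw [hw.bus_reverse hX (hl.1 1), hbus, one_mul] at h1
    have h2 := (h1.comp tendsto_inv_nhdsGT_zero).neg
    rw [neg_neg] at h2
    refine h2.congr fun ε => ?_
    simp only [hθ, hF, Function.comp, one_div]
    ring
  have hθlim2 : Tendsto (fun ε => θ (2 * ε)) (𝓝[>] 0) (𝓝 A) := by
    refine hθlim.comp (tendsto_nhdsWithin_iff.2 ⟨?_, ?_⟩)
    · refine Tendsto.mono_left ?_ nhdsWithin_le_nhds
      exact Continuous.tendsto' (by fun_prop) _ _ (by simp)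
    · filter_upwards [self_mem_nhdsWithin] with ε hε
      exact mul_pos two_pos (mem_Ioi.1 hε)
  have hF1 : ∀ ε, 0 < ε → F ε (-1) = 1 + ε * θ ε := by
    intro ε hε
    have h1 := hhom ε 1 (-(1 / ε)) hε
    rw [mul_one, show ε * -(1 / ε) = -1 by field_simp] at h1
    rw [h1, hθ]
    field_simp
    ring
  have hF2 : ∀ ε, 0 < ε → F ε (-(1 / 2)) = 1 / 2 + ε * θ (2 * ε) := by
    intro ε hε
    have h1 := hhom (1 / 2) (2 * ε) (-1) (by norm_num)
    rw [hF1 _ (by positivity), show 1 / 2 * (2 * ε) = ε by ring,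
      show (1 / 2 : ℝ) * -1 = -(1 / 2) by ring] at h1
    rw [h1]
    ring
  have hineq : ∀ ε, 0 < ε → 1 + 2 * (θ ε - θ (2 * ε)) * (ε + A) ≤ A * θ ε := by
    intro ε hε
    have h1 := neg_bus_inv_mul_le hX hc hv he (by rwa [hv0]) hφ hAv hA0 ht₀
      (show -A < ε by linarith)
    have hqy : e ε ≠ v 0 := by rw [hv0]; exact fun h => hy ⟨_, h⟩
    have h2 := bus_inv_mul_le hX hv hφ (hl.1 ε) hqy
    have h3 : rd ω (e ε) (v 0) = 1 + ε * θ ε := by rw [hv0]; exact hF1 ε hε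
    have h4 : rd ω (e ε) (v (1 / 2)) = 1 / 2 + ε * θ (2 * ε) := by
      rw [← hF2 ε hε, hv_def]
      simp only [hF]
      norm_num
    have h5 := rd_pos (hl.1 ε) (hv.1 0) hqy
    rw [h3] at h5 h2
    rw [h4] at h2
    set P := bus ω v (φ (e ε))
    have h6 : (1 + 2 * ε * (θ ε - θ (2 * ε))) * (ε + A) ≤ A * (1 + ε * θ ε) := by
      have h7 := mul_le_mul_of_nonneg_right h2 (show 0 ≤ ε + A by linarith)
      have h8 := mul_le_mul_of_nonneg_right h1 h5.le
      linarith
    refine le_of_mul_le_mul_left ?_ hε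
    linarith
  have hl1 : Tendsto (fun ε => 1 + 2 * (θ ε - θ (2 * ε)) * (ε + A)) (𝓝[>] 0)
      (𝓝 (1 + 2 * (A - A) * (0 + A))) := by
    have h1 : Tendsto (fun ε : ℝ => ε) (𝓝[>] 0) (𝓝 0) := tendsto_id.mono_left nhdsWithin_le_nhds
    exact ((((hθlim.sub hθlim2).const_mul 2).mul (h1.add_const A))).const_add 1
  have hl2 := le_of_tendsto_of_tendsto hl1 (hθlim.const_mul A)
    (eventually_nhdsWithin_of_forall hineq)
  nlinarith

/-- Any two lines with the same remote point are related by a conformal map, unless the space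
is a single line. -/
theorem exists_conf_line (hX : IsNice X) {ω x : X} {c w : ℝ → X} (hc : IsLine ω c)
    (hw : IsLine ω w) (hx : x ≠ ω) (hxc : x ∉ range c) :
    ∃ g : X → X, IsConf g ∧ g ω = ω ∧ ∀ t, g (c t) = w t := by
  have hpt := hX.ptolemy
  obtain ⟨e, he, h0, hA⟩ := exists_max_busSlope hX hc hw
  have h1 := max_busSlope_eq_one hX hc hw hx hxc he h0 hA
  have hbus : ∀ t, bus ω w (e t) = t := fun t => by
    rw [hw.bus_eq hX he.1, h0, hw.bus_apply hpt, zero_add, h1, mul_one]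
  have hmix : ∀ t u : ℝ, t ≤ 0 → 0 ≤ u → rd ω (e t) (w u) = |t - u| := by
    intro t u ht hu
    rw [abs_of_nonpos (by linarith)]
    apply le_antisymm
    · have h2 := rd_triangle hpt (he.1.1 t) (he.1.1 0) (hw.1 u)
      rw [he.1.2, h0, hw.2, sub_zero, zero_sub, abs_neg, abs_of_nonpos ht, abs_of_nonneg hu] at h2
      linarith
    · have h2 := hw.bus_sub_le hpt (hw.1 u) (he.1.1 t)
      rw [hbus, hw.bus_apply hpt, rd_comm] at h2
      linarith
  set k : ℝ → X := fun t => if t ≤ 0 then e t else w t with hk_def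
  have hkl : IsLine ω k := by
    refine ⟨fun t => ?_, fun t u => ?_⟩
    · simp only [hk_def]
      split_ifs
      · exact he.1.1 t
      · exact hw.1 t
    · simp only [hk_def]
      split_ifs with h2 h3 h3
      · exact he.1.2 t u
      · exact hmix t u h2 (by linarith)
      · rw [rd_comm, abs_sub_comm]; exact hmix u t h3 (by linarith)
      · exact hw.2 t u
  have hk0 : k 0 = w 0 := by simp [hk_def, h0]
  have e1 : e = k := he.1.eq_of_eq hX hkl (t₀ := -1) (t₁ := 0) (by norm_num)
    (by simp [hk_def]) (by rw [h0, hk0])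
  have e2 : k = w := hkl.eq_of_eq hX hw (t₀ := 0) (t₁ := 1) (by norm_num) hk0
    (by simp only [hk_def]; rw [if_neg (by norm_num)])
  obtain ⟨-, g, hg, hgω, heg⟩ := he
  exact ⟨g, hg, hgω, fun t => by rw [← heg, e1, e2]⟩

end

section
open Filter Topology Set


/-- Two distance-like functions with proportional cross-ratios differ by a conformal factor. -/
theorem exists_conformal_factor {Y : Type*} {p p' : Y → Y → ℝ} (hp : ∀ x y, x ≠ y → 0 < p x y)
    (hp' : ∀ x y, x ≠ y → 0 < p' x y) (hs : ∀ x y, p x y = p y x) (hs' : ∀ x y, p' x y = p' y x)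
    (h0 : ∀ x, p x x = 0) (h0' : ∀ x, p' x x = 0)
    (hcr : ∀ x y z u, x ≠ y → x ≠ z → x ≠ u → y ≠ z → y ≠ u → z ≠ u →
      ∃ l : ℝ, 0 < l ∧ p' x y * p' z u = l * (p x y * p z u) ∧
        p' x z * p' y u = l * (p x z * p y u))
    {a b c : Y} (hab : a ≠ b) (hac : a ≠ c) (hbc : b ≠ c) :
    ∃ m : Y → ℝ, (∀ x, 0 < m x) ∧ ∀ x y, p' x y = m x * m y * p x y := by
  set ρ : Y → Y → ℝ := fun x y => p' x y / p x y with hρ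
  have ρpos : ∀ x y, x ≠ y → 0 < ρ x y := fun x y h => div_pos (hp' x y h) (hp x y h)
  have ρs : ∀ x y, ρ x y = ρ y x := fun x y => by simp only [hρ, hs x y, hs' x y]
  have ρcr : ∀ x y z u, x ≠ y → x ≠ z → x ≠ u → y ≠ z → y ≠ u → z ≠ u →
      ρ x y * ρ z u = ρ x z * ρ y u := by
    intro x y z u h1 h2 h3 h4 h5 h6
    obtain ⟨l, hl, e1, e2⟩ := hcr x y z u h1 h2 h3 h4 h5 h6
    have := hp _ _ h1; have := hp _ _ h6; have := hp _ _ h2; have := hp _ _ h5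
    simp only [hρ]
    rw [div_mul_div_comm, div_mul_div_comm, e1, e2]
    field_simp
  set H : Y → Y → Y → ℝ := fun x y z => ρ x y * ρ x z / ρ y z with hH
  have Hs : ∀ x y z, H x y z = H x z y := fun x y z => by
    simp only [hH, ρs y z, mul_comm]
  have H1 : ∀ x y z z', x ≠ y → x ≠ z → x ≠ z' → y ≠ z → y ≠ z' → H x y z = H x y z' := by
    intro x y z z' h1 h2 h3 h4 h5
    rcases eq_or_ne z z' with rfl | h6
    · rfl
    have h7 := ρcr x z y z' h2 h1 h3 h4.symm h6 h5
    have h8 := ρcr x z z' y h2 h3 h1 h6 h4.symm h5.symm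
    have := ρpos _ _ h4; have := ρpos _ _ h5
    simp only [hH]
    rw [div_eq_div_iff (by positivity) (by positivity)]
    rw [ρs z y, ρs z' y] at h8
    linear_combination ρ x y * h8
  have H2 : ∀ x y z y' z', x ≠ y → x ≠ z → x ≠ y' → x ≠ z' → y ≠ z → y' ≠ z' →
      H x y z = H x y' z' := by
    intro x y z y' z' h1 h2 h3 h4 h5 h6
    rcases eq_or_ne y z' with rfl | h7
    · rw [Hs x y']
      exact H1 x y z y' h1 h2 h3 h5 h6.symm
    · rw [H1 x y z z' h1 h2 h4 h5 h7, Hs x y z', Hs x y' z']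
      exact H1 x z' y y' h4 h1 h3 h7.symm h6.symm
  have hex : ∀ x : Y, ∃ y z : Y, x ≠ y ∧ x ≠ z ∧ y ≠ z := by
    intro x
    by_cases h1 : x = a
    · exact ⟨b, c, h1 ▸ hab, h1 ▸ hac, hbc⟩
    by_cases h2 : x = b
    · exact ⟨a, c, h1, h2 ▸ hbc, hac⟩
    · exact ⟨a, b, h1, h2, hab⟩
  have hex2 : ∀ x y : Y, ∃ z : Y, x ≠ z ∧ y ≠ z := by
    intro x y
    by_contra! h
    have h1 := h a; have h2 := h b; have h3 := h c
    by_cases ha : x = a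
    · subst ha
      exact hbc ((h2 hab).symm.trans (h3 hac))
    · have h4 := h1 ha
      subst h4
      by_cases hb : x = b
      · subst hb
        exact hac (h3 hbc)
      · exact hab (h2 hb)
  choose ny nz h1 h2 h3 using hex
  refine ⟨fun x => √(H x (ny x) (nz x)), fun x => Real.sqrt_pos.2 ?_, fun x y => ?_⟩
  · have := ρpos _ _ (h1 x); have := ρpos _ _ (h2 x); have := ρpos _ _ (h3 x)
    positivity
  · rcases eq_or_ne x y with rfl | hxy
    · simp [h0, h0']
    obtain ⟨z, hxz, hyz⟩ := hex2 x y
    beta_reduce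
    rw [H2 x (ny x) (nz x) y z (h1 x) (h2 x) hxy hxz (h3 x) hyz,
      H2 y (ny y) (nz y) x z (h1 y) (h2 y) hxy.symm hyz (h3 y) hxz]
    have p1 := ρpos _ _ hxy; have p2 := ρpos _ _ hxz; have p3 := ρpos _ _ hyz
    have p4 := hp _ _ hxy
    rw [← Real.sqrt_mul (by positivity)]
    have e : H x y z * H y x z = ρ x y ^ 2 := by
      simp only [hH]
      rw [ρs y x]
      field_simp
    rw [e, Real.sqrt_sq p1.le]
    simp only [hρ]
    field_simp

end

section
open Filter Topology Set
variable {X : Type*} [MetricSpace X]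

/-- The circle as the one-point compactification of the line. -/
theorem nonempty_onePoint_homeo_circle (p : Metric.sphere (0 : ℂ) 1) :
    ∃ e : OnePoint ℝ ≃ₜ Metric.sphere (0 : ℂ) 1, e OnePoint.infty = p := by
  have hcard : Module.finrank ℝ ℝ + 1 = Fintype.card (Fin 2) := by simp
  let I := Complex.orthonormalBasisOneI.repr.symm
  let E : Metric.sphere (0 : EuclideanSpace ℝ (Fin 2)) 1 ≃ₜ Metric.sphere (0 : ℂ) 1 :=
    I.toHomeomorph.subtype fun x => by simp
  let e₀ : OnePoint ℝ ≃ₜ Metric.sphere (0 : ℂ) 1 := (onePointEquivSphereOfFinrankEq hcard).trans E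
  let q : Circle := e₀ OnePoint.infty
  let p' : Circle := p
  let R : Circle ≃ₜ Circle := Homeomorph.mulRight (q⁻¹ * p')
  refine ⟨e₀.trans R, ?_⟩
  change q * (q⁻¹ * p') = p'
  rw [mul_inv_cancel_left]

/-- A circle on which the Ptolemy equality holds. -/
def IsPtolemaicCircle (σ : Set X) : Prop :=
  Nonempty (σ ≃ₜ Metric.sphere (0 : ℂ) 1) ∧
  ∀ x ∈ σ, ∀ y ∈ σ, ∀ z ∈ σ, ∀ u ∈ σ, x ≠ y → x ≠ z → x ≠ u → y ≠ z → y ≠ u → z ≠ u →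
    u ∉ connectedComponentIn (σ \ {x, z}) y →
    dist x z * dist y u = dist x y * dist z u + dist x u * dist y z

theorem IsPtolemaicCircle.exists_line {σ : Set X} (hσ : IsPtolemaicCircle σ) {ω : X}
    (hω : ω ∈ σ) : ∃ c, IsLine ω c ∧ range c = σ \ {ω} := by
  obtain ⟨⟨E⟩, hpt⟩ := hσ
  obtain ⟨e₀, he₀⟩ := nonempty_onePoint_homeo_circle (E ⟨ω, hω⟩)
  set e : OnePoint ℝ ≃ₜ σ := e₀.trans E.symm with he
  have heω : e OnePoint.infty = ⟨ω, hω⟩ := by simp [he, he₀]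
  set k : ℝ → X := fun t => e (t : OnePoint ℝ) with hk
  have hkσ : ∀ t, k t ∈ σ := fun t => (e t).2
  have hinj : Function.Injective k := fun t u h =>
    OnePoint.coe_injective (e.injective (Subtype.ext h))
  have hkω : ∀ t, k t ≠ ω := fun t h => by
    have : e (t : OnePoint ℝ) = e OnePoint.infty := by rw [heω]; exact Subtype.ext h
    exact OnePoint.coe_ne_infty t (e.injective this)
  have hkc : Continuous k :=
    continuous_subtype_val.comp (e.continuous.comp OnePoint.continuous_coe)
  have hlim : Tendsto k (cocompact ℝ) (𝓝 ω) := by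
    have h1 : Tendsto (fun t : ℝ => ((e (t : OnePoint ℝ) : σ) : X)) (coclosedCompact ℝ)
        (𝓝 ((e OnePoint.infty : σ) : X)) :=
      ((continuous_subtype_val.comp e.continuous).tendsto _).comp OnePoint.tendsto_coe_infty
    rw [heω] at h1
    rwa [coclosedCompact_eq_cocompact] at h1
  have hrange : range k = σ \ {ω} := by
    ext x
    constructor
    · rintro ⟨t, rfl⟩
      exact ⟨hkσ t, hkω t⟩
    · rintro ⟨hx, hxω⟩
      obtain ⟨p, hp⟩ := e.surjective ⟨x, hx⟩
      induction p using OnePoint.rec with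
      | infty => rw [heω] at hp; exact absurd (congrArg Subtype.val hp).symm hxω
      | coe t => exact ⟨t, congrArg Subtype.val hp⟩
  have hadd : ∀ a b d, a < b → b < d →
      rd ω (k a) (k d) = rd ω (k a) (k b) + rd ω (k b) (k d) := by
    intro a b d hab hbd
    have hsep : k d ∉ connectedComponentIn (σ \ {ω, k b}) (k a) := by
      intro hmem
      have hconn : IsPreconnected (connectedComponentIn (σ \ {ω, k b}) (k a)) :=
        isPreconnected_connectedComponentIn
      set T := connectedComponentIn (σ \ {ω, k b}) (k a) with hT
      have hTs : T ⊆ σ \ {ω, k b} := connectedComponentIn_subset _ _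
      have ha : k a ∈ T := mem_connectedComponentIn ⟨hkσ a, by
        simp only [mem_insert_iff, mem_singleton_iff, not_or]
        exact ⟨hkω a, fun h => hab.ne (hinj h)⟩⟩
      have hTp : IsPreconnected (k ⁻¹' T) := by
        have hemb : IsInducing k :=
          IsInducing.subtypeVal.comp (e.isInducing.comp OnePoint.isOpenEmbedding_coe.isInducing)
        rw [← hemb.isPreconnected_image, image_preimage_eq_of_subset]
        · exact hconn
        · rw [hrange]
          intro x hx
          have := hTs hx
          simp only [Set.mem_sdiff, mem_insert_iff, mem_singleton_iff, not_or] at this ⊢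
          exact ⟨this.1, this.2.1⟩
      have hb : b ∈ k ⁻¹' T := hTp.ordConnected.out ha hmem ⟨hab.le, hbd.le⟩
      exact (hTs hb).2 (by simp)
    have h1 := hpt ω hω (k a) (hkσ a) (k b) (hkσ b) (k d) (hkσ d) (hkω a).symm (hkω b).symm
      (hkω d).symm (hinj.ne hab.ne) (hinj.ne (hab.trans hbd).ne) (hinj.ne hbd.ne) hsep
    have p1 := dist_pos.2 (hkω a); have p2 := dist_pos.2 (hkω b); have p3 := dist_pos.2 (hkω d)
    rw [dist_comm ω, dist_comm ω, dist_comm ω] at h1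
    unfold rd
    field_simp
    linarith
  set F : ℝ → ℝ := fun t => if 0 ≤ t then rd ω (k 0) (k t) else -rd ω (k 0) (k t) with hF
  have hFd : ∀ a b, a < b → F b - F a = rd ω (k a) (k b) := by
    intro a b hab
    simp only [hF]
    split_ifs with h1 h2 h2
    · rcases h2.eq_or_lt with rfl | h2
      · rw [rd_self, sub_zero]
      · rw [hadd 0 a b h2 hab]; ring
    · push Not at h2
      rcases h1.eq_or_lt with rfl | h1
      · rw [rd_self, rd_comm]; ring
      · rw [hadd a 0 b h2 h1, rd_comm ω (k a) (k 0)]; ring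
    · linarith
    · push Not at h1 h2
      have := hadd a b 0 hab h1
      rw [rd_comm ω (k 0) (k b), rd_comm ω (k 0) (k a), this]; ring
  have hFabs : ∀ a b, rd ω (k a) (k b) = |F a - F b| := by
    intro a b
    rcases lt_trichotomy a b with h | rfl | h
    · rw [abs_sub_comm, hFd a b h, abs_of_nonneg (rd_nonneg _ _ _)]
    · simp [rd_self]
    · rw [hFd b a h, abs_of_nonneg (rd_nonneg _ _ _), rd_comm]
  have hFc : Continuous F := by
    rw [continuous_iff_continuousAt]
    intro a
    have h1 : Tendsto (fun b => rd ω (k b) (k a)) (𝓝 a) (𝓝 (rd ω (k a) (k a))) :=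
      tendsto_rd (hkc.tendsto a) tendsto_const_nhds (hkω a) (hkω a)
    simp_rw [rd_self, hFabs] at h1
    exact tendsto_iff_dist_tendsto_zero.2 h1
  have hunb : Tendsto (fun t => rd ω (k 0) (k t)) (cocompact ℝ) atTop := by
    have h1 : Tendsto (fun t => dist (k 0) (k t) / dist (k 0) ω) (cocompact ℝ)
        (𝓝 (dist (k 0) ω / dist (k 0) ω)) := (tendsto_const_nhds.dist hlim).div_const _
    rw [div_self (dist_pos.2 (hkω 0)).ne'] at h1
    have h2 : Tendsto (fun t => (dist (k t) ω)⁻¹) (cocompact ℝ) atTop := by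
      refine tendsto_inv_nhdsGT_zero.comp (tendsto_nhdsWithin_iff.2
        ⟨tendsto_iff_dist_tendsto_zero.1 hlim, .of_forall fun t => dist_pos.2 (hkω t)⟩)
    refine (h1.pos_mul_atTop one_pos h2).congr fun t => ?_
    unfold rd
    rw [← div_eq_mul_inv, div_div]
  have hsurj : Function.Surjective F := by
    refine hFc.surjective ?_ ?_
    · refine (hunb.mono_left atTop_le_cocompact).congr' ?_
      filter_upwards [eventually_ge_atTop 0] with t ht
      simp only [hF, if_pos ht]
    · refine (tendsto_neg_atTop_atBot.comp (hunb.mono_left atBot_le_cocompact)).congr' ?_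
      filter_upwards [eventually_lt_atBot 0] with t ht
      simp only [hF, if_neg (not_le.2 ht), Function.comp]
  have hFinj : Function.Injective F := fun a b h => by
    by_contra hne
    have := rd_pos (hkω a) (hkω b) (hinj.ne hne)
    rw [hFabs, h, sub_self, abs_zero] at this
    exact this.false
  choose G hG using hsurj
  refine ⟨fun t => k (G t), ⟨fun t => hkω _, fun t u => by rw [hFabs, hG, hG]⟩, ?_⟩
  rw [← hrange]
  refine Subset.antisymm (range_subset_iff.2 fun t => mem_range_self _)
    (range_subset_iff.2 fun t => ⟨F t, ?_⟩)
  change k (G (F t)) = k t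
  rw [hFinj (hG (F t))]

theorem range_relLine {ω : X} {c : ℝ → X} (hc : IsLine ω c) (t₀ : ℝ) :
    insert (c t₀) (range (relLine ω c t₀)) = insert ω (range c) := by
  have h0 := dist_pos.2 (hc.1 t₀)
  ext x
  simp only [mem_insert_iff, mem_range]
  constructor
  · rintro (rfl | ⟨u, rfl⟩)
    · exact .inr ⟨_, rfl⟩
    · rcases eq_or_ne u 0 with rfl | hu
      · exact .inl (relLine_zero _ _ _)
      · rw [relLine_of_ne _ _ _ hu]; exact .inr ⟨_, rfl⟩
  · rintro (rfl | ⟨t, rfl⟩)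
    · exact .inr ⟨0, relLine_zero _ _ _⟩
    · rcases eq_or_ne t t₀ with rfl | ht
      · exact .inl rfl
      · right
        have h1 := sub_ne_zero.2 ht.symm
        have h2 : (dist (c t₀) ω ^ 2)⁻¹ / (t₀ - t) ≠ 0 := div_ne_zero (by positivity) h1
        refine ⟨_, (relLine_of_ne _ _ _ h2).trans ?_⟩
        congr 1
        field_simp
        ring

theorem IsLine.ptolemy_eq [CompactSpace X] {ω y z u : X} {c : ℝ → X} (hc : IsLine ω c)
    (hy : y ∈ range c) (hz : z ∈ range c) (hu : u ∈ range c) (hyz : y ≠ z) (hzu : z ≠ u)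
    (h : u ∉ connectedComponentIn (insert ω (range c) \ {ω, z}) y) :
    dist ω z * dist y u = dist ω y * dist z u + dist ω u * dist y z := by
  obtain ⟨p, rfl⟩ := hy
  obtain ⟨r, rfl⟩ := hz
  obtain ⟨q, rfl⟩ := hu
  have hr : r ∈ uIcc p q := by
    by_contra hr
    refine h ?_
    have h1 : IsPreconnected (c '' uIcc p q) :=
      isPreconnected_uIcc.image _ hc.continuous.continuousOn
    refine h1.subset_connectedComponentIn (mem_image_of_mem _ left_mem_uIcc) ?_
      (mem_image_of_mem _ right_mem_uIcc)
    rintro _ ⟨s, hs, rfl⟩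
    refine ⟨.inr ⟨s, rfl⟩, ?_⟩
    simp only [mem_insert_iff, mem_singleton_iff, not_or]
    refine ⟨hc.1 s, fun h => hr ?_⟩
    rwa [← hc.injective h]
  have h1 : |p - q| = |p - r| + |r - q| := by
    rcases mem_uIcc.1 hr with ⟨h1, h2⟩ | ⟨h1, h2⟩
    · rw [abs_of_nonpos (by linarith), abs_of_nonpos (by linarith), abs_of_nonpos (by linarith)]
      ring
    · rw [abs_of_nonneg (by linarith), abs_of_nonneg (by linarith), abs_of_nonneg (by linarith)]
      ring
  rw [← hc.2, ← hc.2, ← hc.2] at h1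
  have p1 := dist_pos.2 (hc.1 p); have p2 := dist_pos.2 (hc.1 q); have p3 := dist_pos.2 (hc.1 r)
  unfold rd at h1
  field_simp at h1
  rw [dist_comm ω, dist_comm ω, dist_comm ω]
  linarith

theorem IsLine.isPtolemaicCircle [CompactSpace X] {ω : X} {c : ℝ → X}
    (hc : IsLine ω c) : IsPtolemaicCircle (insert ω (range c)) := by
  constructor
  · set K : OnePoint ℝ → X := fun p => p.elim ω c with hK
    have hKc : Continuous K := by
      rw [OnePoint.continuous_iff]
      refine ⟨?_, hc.continuous⟩
      rw [coclosedCompact_eq_cocompact]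
      refine tendsto_remote_of_rd (hc.1 0) hc.1 ?_
      have h1 : Tendsto (fun t : ℝ => |t|) (cocompact ℝ) atTop := tendsto_norm_cocompact_atTop
      refine h1.congr fun t => ?_
      change |t| = rd ω (c t) (c 0)
      rw [hc.2, sub_zero]
    have hKi : Function.Injective K := by
      intro p q h
      induction p using OnePoint.rec with
      | infty =>
        induction q using OnePoint.rec with
        | infty => rfl
        | coe t => exact absurd h.symm (hc.1 t)
      | coe s =>
        induction q using OnePoint.rec with
        | infty => exact absurd h (hc.1 s)
        | coe t => rw [hc.injective h]
    have hKr : range K = insert ω (range c) := by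
      ext x
      constructor
      · rintro ⟨p, rfl⟩
        induction p using OnePoint.rec with
        | infty => exact .inl rfl
        | coe s => exact .inr ⟨s, rfl⟩
      · rintro (rfl | ⟨s, rfl⟩)
        · exact ⟨OnePoint.infty, rfl⟩
        · exact ⟨s, rfl⟩
    obtain ⟨e, -⟩ := nonempty_onePoint_homeo_circle ⟨1, by simp⟩
    rw [← hKr]
    exact ⟨(hKc.isClosedEmbedding hKi).isEmbedding.toHomeomorph.symm.trans e⟩
  · intro x hx y hy z hz u hu hxy hxz hxu hyz hyu hzu h
    obtain ⟨e, he, her⟩ : ∃ e, IsLine x e ∧ insert x (range e) = insert ω (range c) := by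
      rcases hx with rfl | ⟨t, rfl⟩
      · exact ⟨c, hc, rfl⟩
      · exact ⟨_, isLine_relLine hc t, range_relLine hc t⟩
    rw [← her] at h hy hz hu
    exact he.ptolemy_eq (hy.resolve_left hxy.symm) (hz.resolve_left hxz.symm)
      (hu.resolve_left hxu.symm) hyz hzu h

end

section
open Filter Topology Set
variable {X : Type*}

theorem ExtMetric.fd_self (d : ExtMetric X) (x : X) : d.fd x x = 0 := by
  simp [fd, d.d_self]

theorem ExtMetric.fd_comm (d : ExtMetric X) (x y : X) : d.fd x y = d.fd y x := by
  simp [fd, d.symm x y]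

theorem ExtMetric.fd_pos (d : ExtMetric X) {x y : X} (h : x ≠ y) : 0 < d.fd x y := by
  unfold fd
  split_ifs with h1
  · exact one_pos
  · exact ENNReal.toReal_pos (d.pos x y h).ne' h1

theorem ExtMetric.fd_nonneg (d : ExtMetric X) (x y : X) : 0 ≤ d.fd x y := by
  unfold fd
  split_ifs
  · exact zero_le_one
  · exact ENNReal.toReal_nonneg

theorem admissible_of_ne {x y z u : X} (hxy : x ≠ y) (hzu : z ≠ u) : Admissible x y z u :=
  ⟨fun h => hxy h.1, fun h => hxy h.1, fun h => hzu h.2, fun h => hzu h.2⟩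

theorem Admissible.map {x y z u : X} (h : Admissible x y z u) {f : X → X}
    (hf : Function.Injective f) : Admissible (f x) (f y) (f z) (f u) := by
  simpa only [Admissible, hf.eq_iff] using h

theorem ExtMetric.fd_ptolemy {S : MobiusStructure X} (hpt : IsPtolemyStructure S) {d : ExtMetric X}
    (hd : d ∈ S.M) (x y z u : X) :
    d.fd x z * d.fd y u ≤ d.fd x y * d.fd z u + d.fd x u * d.fd y z := by
  by_cases h : Admissible x y z u
  · exact (hpt d hd x y z u h).2.1
  · have h1 := d.fd_nonneg
    have h2 := mul_nonneg (h1 x y) (h1 z u)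
    have h3 := mul_nonneg (h1 x u) (h1 y z)
    have h4 : d.fd x z * d.fd y u = 0 := by
      have h : (x = y ∧ y = z) ∨ (x = y ∧ y = u) ∨ (x = z ∧ z = u) ∨ (y = z ∧ z = u) := by
        unfold Admissible at h
        tauto
      rcases h with ⟨rfl, rfl⟩ | ⟨rfl, rfl⟩ | ⟨rfl, rfl⟩ | ⟨rfl, rfl⟩ <;> simp [fd_self]
    linarith

theorem projEq_of_factor {d : ExtMetric X} {p : X → X → ℝ} {m : X → ℝ} (hm : ∀ x, 0 < m x)
    (h : ∀ x y, p x y = m x * m y * d.fd x y) (x y z u : X) :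
    ProjEq (crtVec d x y z u) (p x y * p z u, p x z * p y u, p x u * p y z) := by
  refine ⟨m x * m y * m z * m u,
    by have := hm x; have := hm y; have := hm z; have := hm u; positivity, ?_⟩
  simp only [crtVec, h, Prod.smul_mk, smul_eq_mul, Prod.mk.injEq]
  refine ⟨?_, ?_, ?_⟩ <;> ring

theorem MobiusStructure.mem_of_factor (S : MobiusStructure X) {d d' : ExtMetric X} (hd : d ∈ S.M)
    {m : X → ℝ} (hm : ∀ x, 0 < m x) (h : ∀ x y, d'.fd x y = m x * m y * d.fd x y) : d' ∈ S.M :=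
  S.maximal d' fun d'' hd'' x y z u ha =>
    (S.compat d hd d'' hd'' x y z u ha).trans' (projEq_of_factor hm h x y z u)

/-- A metric, viewed as an extended metric without a remote point. -/
noncomputable def extDist (X : Type*) [MetricSpace X] : ExtMetric X where
  d := edist
  rem := none
  symm := edist_comm
  d_self := edist_self
  pos _ _ h := edist_pos.2 h
  triangle := edist_triangle
  d_eq_top_iff x y := by simp [edist_ne_top]

/-- A metric representing a Ptolemy structure. -/
noncomputable abbrev boundedMetric {S : MobiusStructure X} (hpt : IsPtolemyStructure S)
    {d : ExtMetric X} (hd : d ∈ S.M) {a b : X} (hab : a ≠ b) : MetricSpace X where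
  dist x y := (d.fd x a + d.fd x b)⁻¹ * (d.fd y a + d.fd y b)⁻¹ * d.fd x y
  dist_self x := by simp [d.fd_self]
  dist_comm x y := by rw [d.fd_comm x y]; ring
  dist_triangle x y z := by
    have hw : ∀ x, 0 < d.fd x a + d.fd x b := fun x => by
      have h1 := d.fd_nonneg x a; have h2 := d.fd_nonneg x b
      rcases eq_or_ne x a with rfl | h
      · have := d.fd_pos hab; linarith
      · have := d.fd_pos h; linarith
    have h1 := ExtMetric.fd_ptolemy hpt hd x y z a
    have h2 := ExtMetric.fd_ptolemy hpt hd x y z b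
    have := hw x; have := hw y; have := hw z
    have key : d.fd x z * (d.fd y a + d.fd y b) ≤
        d.fd x y * (d.fd z a + d.fd z b) + d.fd y z * (d.fd x a + d.fd x b) := by linarith
    rw [← sub_nonneg] at key ⊢
    have e : (d.fd x a + d.fd x b)⁻¹ * (d.fd y a + d.fd y b)⁻¹ * d.fd x y +
        (d.fd y a + d.fd y b)⁻¹ * (d.fd z a + d.fd z b)⁻¹ * d.fd y z -
        (d.fd x a + d.fd x b)⁻¹ * (d.fd z a + d.fd z b)⁻¹ * d.fd x z =
        (d.fd x y * (d.fd z a + d.fd z b) + d.fd y z * (d.fd x a + d.fd x b) -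
          d.fd x z * (d.fd y a + d.fd y b)) * ((d.fd x a + d.fd x b)⁻¹ *
          (d.fd y a + d.fd y b)⁻¹ * (d.fd z a + d.fd z b)⁻¹) := by
      field_simp
    rw [e]
    positivity
  eq_of_dist_eq_zero {x y} h := by
    have hw : ∀ x, 0 < d.fd x a + d.fd x b := fun x => by
      have h1 := d.fd_nonneg x a; have h2 := d.fd_nonneg x b
      rcases eq_or_ne x a with rfl | h
      · have := d.fd_pos hab; linarith
      · have := d.fd_pos h; linarith
    by_contra hne
    have := hw x; have := hw y; have := d.fd_pos hne
    have : 0 < (d.fd x a + d.fd x b)⁻¹ * (d.fd y a + d.fd y b)⁻¹ * d.fd x y := by positivity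
    exact this.ne' h

end

section
open Filter Topology Set
variable {X : Type*} [MetricSpace X]

theorem extDist_fd (x y : X) : (extDist X).fd x y = dist x y := by
  simp [ExtMetric.fd, extDist, edist_dist]

theorem crtVec_extDist (x y z u : X) : crtVec (extDist X) x y z u =
    (dist x y * dist z u, dist x z * dist y u, dist x u * dist y z) := by
  simp only [crtVec, extDist_fd]

theorem extDist_boundedMetric_mem {X : Type*} {S : MobiusStructure X} (hpt : IsPtolemyStructure S)
    {d : ExtMetric X} (hd : d ∈ S.M) {a b : X} (hab : a ≠ b) :
    @extDist X (boundedMetric hpt hd hab) ∈ S.M := by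
  let _ := boundedMetric hpt hd hab
  refine S.mem_of_factor hd (m := fun x => (d.fd x a + d.fd x b)⁻¹) (fun x => ?_) fun x y => ?_
  · have h1 := d.fd_nonneg x a; have h2 := d.fd_nonneg x b
    rw [inv_pos]
    rcases eq_or_ne x a with rfl | h
    · have := d.fd_pos hab; linarith
    · have := d.fd_pos h; linarith
  · rw [extDist_fd]; rfl

open Classical in
/-- The metric inversion with remote point `ω`, as an extended metric. -/
noncomputable def extRd (hpt : PtolemyIneq X) (ω : X) : ExtMetric X where
  d x y := if x ≠ y ∧ (x = ω ∨ y = ω) then ⊤ else ENNReal.ofReal (rd ω x y)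
  rem := some ω
  symm x y := by simp only [ne_comm, or_comm, rd_comm ω x y]
  d_self x := by simp [rd_self]
  pos x y h := by
    split_ifs with h1
    · exact ENNReal.zero_lt_top
    · have h2 : ¬(x = ω ∨ y = ω) := fun h2 => h1 ⟨h, h2⟩
      push Not at h2
      exact ENNReal.ofReal_pos.2 (rd_pos h2.1 h2.2 h)
  triangle x y z := by
    rcases eq_or_ne x y with rfl | hxy
    · simp
    rcases eq_or_ne y z with rfl | hyz
    · simp
    by_cases h : x = ω ∨ y = ω ∨ z = ω
    · rcases h with rfl | rfl | rfl
      · simp [hxy]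
      · simp [hyz]
      · simp [hyz]
    · push Not at h
      obtain ⟨h1, h2, h3⟩ := h
      simp only [h1, h2, h3, or_false, and_false, if_false]
      rw [← ENNReal.ofReal_add (rd_nonneg _ _ _) (rd_nonneg _ _ _)]
      exact ENNReal.ofReal_le_ofReal (rd_triangle hpt h1 h2 h3)
  d_eq_top_iff x y := by
    simp only [Option.some.injEq, @eq_comm _ ω]
    simp
    tauto

theorem extRd_d (hpt : PtolemyIneq X) {ω o x : X} (hx : x ≠ ω) (ho : o ≠ ω) :
    (extRd hpt ω).d x o = ENNReal.ofReal (rd ω x o) := by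
  simp [extRd, hx, ho]

open Classical in
theorem extRd_mem {S : MobiusStructure X} (hS : extDist X ∈ S.M) (hpt : PtolemyIneq X) (ω : X) :
    extRd hpt ω ∈ S.M := by
  refine S.mem_of_factor hS (m := fun x => if x = ω then 1 else (dist x ω)⁻¹) (fun x => ?_)
    fun x y => ?_
  · split_ifs with h
    · exact one_pos
    · exact inv_pos.2 (dist_pos.2 h)
  · rw [extDist_fd]
    rcases eq_or_ne x y with rfl | hxy
    · simp [ExtMetric.fd_self]
    rcases eq_or_ne x ω with rfl | hx
    · have := (dist_pos.2 hxy).ne'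
      simp [ExtMetric.fd, extRd, hxy, hxy.symm, dist_comm y x, this]
    rcases eq_or_ne y ω with rfl | hy
    · have := (dist_pos.2 hxy).ne'
      simp [ExtMetric.fd, extRd, hxy, this]
    · rw [ExtMetric.fd, extRd_d hpt hx hy, if_neg ENNReal.ofReal_ne_top,
        ENNReal.toReal_ofReal (rd_nonneg _ _ _), if_neg hx, if_neg hy, rd, div_eq_mul_inv, mul_inv]
      ring

theorem ptolemyIneq_of_mem {S : MobiusStructure X} (hS : extDist X ∈ S.M)
    (hpt : IsPtolemyStructure S) : PtolemyIneq X := fun x y z u => by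
  simpa only [extDist_fd] using ExtMetric.fd_ptolemy hpt hS x y z u

theorem mobiusTop_eq {S : MobiusStructure X} (hS : extDist X ∈ S.M) (hcomp : MobiusCompact S) :
    mobiusTop S = PseudoMetricSpace.toUniformSpace.toTopologicalSpace := by
  have hle : mobiusTop S ≤ PseudoMetricSpace.toUniformSpace.toTopologicalSpace := by
    intro s hs
    rw [Metric.isOpen_iff] at hs
    choose! ε hε hsub using hs
    have e : s = ⋃ x ∈ s, Metric.ball x (ε x) := by
      ext y
      simp only [mem_iUnion]
      exact ⟨fun hy => ⟨y, hy, Metric.mem_ball_self (hε y hy)⟩,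
        fun ⟨x, hx, hy⟩ => hsub x hx hy⟩
    rw [e]
    refine @isOpen_biUnion X X (mobiusTop S) s _ fun x hx => ?_
    refine TopologicalSpace.isOpen_generateFrom_of_mem ⟨extDist X, hS, x, by simp [extDist],
      ENNReal.ofReal (ε x), ENNReal.ofReal_pos.2 (hε x hx), ENNReal.ofReal_ne_top, .inl ?_⟩
    ext y
    simp [extDist, edist_lt_ofReal]
  refine le_antisymm hle ?_
  have hcont : @Continuous X X (mobiusTop S) _ id := continuous_id_iff_le.2 hle
  have h1 : @CompactSpace X (mobiusTop S) := hcomp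
  have h2 := @Continuous.isClosedMap X X (mobiusTop S) _ h1 _ id hcont
  intro s hs
  rw [← @isClosed_compl_iff X _] 
  have h3 : @IsClosed X (mobiusTop S) sᶜ := @isClosed_compl_iff X (mobiusTop S) s |>.2 hs
  simpa using h2 _ h3

theorem compactSpace_of_mobiusCompact {S : MobiusStructure X} (hS : extDist X ∈ S.M)
    (hcomp : MobiusCompact S) : CompactSpace X := by
  have h := hcomp
  unfold MobiusCompact at h
  rwa [mobiusTop_eq hS hcomp] at h

theorem isMobiusAuto_of_isConf {S : MobiusStructure X} (hS : extDist X ∈ S.M) {f : X → X}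
    (hf : IsConf f) : IsMobiusAuto S f := by
  have hinj := hf.injective
  refine ⟨⟨hinj, hf.1⟩, fun d hd x y z u ha => ?_⟩
  obtain ⟨-, m, hm, h⟩ := hf
  have h1 := projEq_of_factor (d := extDist X) (p := fun x y => dist (f x) (f y)) hm
    (fun x y => by rw [extDist_fd, h]) x y z u
  rw [← crtVec_extDist] at h1
  have h2 := S.compat _ hS d hd x y z u ha
  have h3 := S.compat _ hS d hd _ _ _ _ (ha.map hinj)
  exact (h2.trans' h1).symm.trans' h3

end

section
open Filter Topology Set
variable {X : Type*} [MetricSpace X]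

theorem exists_factor_of_projEq {Y : Type*} {i j : Y → X} (hi : Function.Injective i)
    (hj : Function.Injective j)
    (h : ∀ x y z u : Y, Admissible (i x) (i y) (i z) (i u) →
      ProjEq (crtVec (extDist X) (i x) (i y) (i z) (i u))
        (crtVec (extDist X) (j x) (j y) (j z) (j u)))
    {a b c : Y} (hab : a ≠ b) (hac : a ≠ c) (hbc : b ≠ c) :
    ∃ m : Y → ℝ, (∀ x, 0 < m x) ∧ ∀ x y, dist (j x) (j y) = m x * m y * dist (i x) (i y) := by
  refine exists_conformal_factor (p := fun x y => dist (i x) (i y))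
    (p' := fun x y => dist (j x) (j y)) (fun x y hxy => dist_pos.2 (hi.ne hxy))
    (fun x y hxy => dist_pos.2 (hj.ne hxy)) (fun x y => dist_comm _ _) (fun x y => dist_comm _ _)
    (fun x => dist_self _) (fun x => dist_self _) ?_ hab hac hbc
  intro x y z u h1 _ _ _ _ h6
  obtain ⟨l, hl, e⟩ := h x y z u (admissible_of_ne (hi.ne h1) (hi.ne h6))
  rw [crtVec_extDist, crtVec_extDist] at e
  simp only [Prod.smul_mk, smul_eq_mul, Prod.mk.injEq] at e
  exact ⟨l, hl, e.1, e.2.1⟩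

theorem isConf_of_isMobiusAuto {S : MobiusStructure X} (hS : extDist X ∈ S.M) {f : X → X}
    (hf : IsMobiusAuto S f) {a b c : X} (hab : a ≠ b) (hac : a ≠ c) (hbc : b ≠ c) : IsConf f :=
  ⟨hf.1.2, exists_factor_of_projEq (i := fun x => x) (fun _ _ h => h) hf.1.1 (hf.2 _ hS)
    hab hac hbc⟩

theorem isPtolemyCircle_iff {S : MobiusStructure X} (hS : extDist X ∈ S.M)
    (hcomp : MobiusCompact S) {σ : Set X} : IsPtolemyCircle S σ ↔ IsPtolemaicCircle σ := by
  have h1 : HomeoToCircle S σ ↔ Nonempty (σ ≃ₜ Metric.sphere (0 : ℂ) 1) := by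
    unfold HomeoToCircle
    rw [mobiusTop_eq hS hcomp]
  have h2 : ∀ F x, mobiusCCIn S F x = connectedComponentIn F x := by
    intro F x
    unfold mobiusCCIn
    rw [mobiusTop_eq hS hcomp]
  unfold IsPtolemyCircle IsPtolemaicCircle SeparatesIn
  rw [h1]
  simp only [h2]
  refine and_congr_right fun _ => ⟨fun h x hx y hy z hz u hu n1 n2 n3 n4 n5 n6 hsep => ?_,
    fun h d hd x hx y hy z hz u hu n1 n2 n3 n4 n5 n6 hsep => ?_⟩
  · have e := h _ hS x hx y hy z hz u hu n1 n2 n3 n4 n5 n6 hsep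
    simp only [extDist, edist_dist] at e
    rw [← ENNReal.ofReal_mul dist_nonneg, ← ENNReal.ofReal_mul dist_nonneg,
      ← ENNReal.ofReal_mul dist_nonneg, ← ENNReal.ofReal_add (by positivity) (by positivity),
      ENNReal.ofReal_eq_ofReal_iff (by positivity) (by positivity)] at e
    exact e
  · have e := h x hx y hy z hz u hu n1 n2 n3 n4 n5 n6 hsep
    obtain ⟨l, hl, e1⟩ := S.compat _ hS d hd x y z u (admissible_of_ne n1 n6)
    rw [crtVec_extDist] at e1
    simp only [crtVec, Prod.smul_mk, smul_eq_mul, Prod.mk.injEq] at e1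
    have e2 : d.fd x z * d.fd y u = d.fd x y * d.fd z u + d.fd x u * d.fd y z := by
      rw [e1.1, e1.2.1, e1.2.2, e]; ring
    by_cases hr : d.rem = some x ∨ d.rem = some y ∨ d.rem = some z ∨ d.rem = some u
    · have ht : ∀ {p q r s : X}, p ≠ q → r ≠ s → (d.rem = some p ∨ d.rem = some q) →
          d.d p q * d.d r s = ⊤ := fun n m hp => by
        rw [(d.d_eq_top_iff _ _).2 ⟨n, hp⟩, ENNReal.top_mul (d.pos _ _ m).ne']
      have ht' : ∀ {p q r s : X}, p ≠ q → r ≠ s → (d.rem = some p ∨ d.rem = some q) →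
          d.d r s * d.d p q = ⊤ := fun n m hp => by rw [mul_comm, ht n m hp]
      rcases hr with hr | hr | hr | hr
      · rw [ht n2 n5 (.inl hr), ht n1 n6 (.inl hr), top_add]
      · rw [ht' n5 n2 (.inl hr), ht n1 n6 (.inr hr), top_add]
      · rw [ht n2 n5 (.inr hr), ht' n6 n1 (.inl hr), top_add]
      · rw [ht' n5 n2 (.inr hr), ht' n6 n1 (.inr hr), top_add]
    · push Not at hr
      obtain ⟨r1, r2, r3, r4⟩ := hr
      have hd' : ∀ {p q : X}, d.rem ≠ some p → d.rem ≠ some q →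
          d.d p q = ENNReal.ofReal (d.fd p q) := fun {p q} hp hq => by
        have : d.d p q ≠ ⊤ := fun h => ((d.d_eq_top_iff _ _).1 h).2.elim hp hq
        rw [ExtMetric.fd, if_neg this, ENNReal.ofReal_toReal this]
      have hn := d.fd_nonneg
      rw [hd' r1 r3, hd' r2 r4, hd' r1 r2, hd' r3 r4, hd' r1 r4, hd' r2 r3,
        ← ENNReal.ofReal_mul (hn _ _), ← ENNReal.ofReal_mul (hn _ _),
        ← ENNReal.ofReal_mul (hn _ _), ← ENNReal.ofReal_add (mul_nonneg (hn _ _) (hn _ _))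
          (mul_nonneg (hn _ _) (hn _ _)), e2]

theorem hasInversions_of_propertyI {S : MobiusStructure X} (hS : extDist X ∈ S.M)
    (hcomp : MobiusCompact S) (hpt : PtolemyIneq X) (hI : PropertyI S)
    {a b c : X} (hab : a ≠ b) (hac : a ≠ c) (hbc : b ≠ c) : HasInversions X := by
  have : CompactSpace X := compactSpace_of_mobiusCompact hS hcomp
  intro ω o hne r hr
  obtain ⟨φ, ⟨hφ, hinv, hfix, hφo, hsph, hcir⟩, -⟩ := hI o ω hne.symm
    {x | (extRd hpt ω).d x o = ENNReal.ofReal r}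
    ⟨extRd hpt ω, extRd_mem hS hpt ω, rfl, ENNReal.ofReal r, ENNReal.ofReal_pos.2 hr,
      ENNReal.ofReal_ne_top, rfl⟩
  refine ⟨φ, isConf_of_isMobiusAuto hS hφ hab hac hbc, hinv, hfix, ?_, fun x hx hxr => ?_,
    fun c hc hc0 t => ?_⟩
  · rw [← hφo, hinv]
  · have h1 : φ x ∈ {x | (extRd hpt ω).d x o = ENNReal.ofReal r} := by
      rw [← hsph]
      refine mem_image_of_mem _ ?_
      rw [mem_ofPred, extRd_d hpt hx hne.symm, hxr]
    rw [mem_ofPred] at h1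
    have h2 : φ x ≠ ω := by
      intro h2
      rw [h2] at h1
      refine ENNReal.ofReal_ne_top (r := r) ?_
      rw [← h1, ExtMetric.d_eq_top_iff]
      exact ⟨hne, .inl rfl⟩
    rwa [extRd_d hpt h2 hne.symm, ENNReal.ofReal_eq_ofReal_iff (rd_nonneg _ _ _) hr.le] at h1
  · have h1 := hcir (insert ω (range c)) ((isPtolemyCircle_iff hS hcomp).2 hc.isPtolemaicCircle)
      (.inr ⟨0, hc0⟩) (.inl rfl)
    have h2 : φ (c t) ∈ insert ω (range c) := by
      rw [← h1]
      exact mem_image_of_mem _ (.inr ⟨t, rfl⟩)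
    exact h2.symm

theorem isNice_of_propertyI {S : MobiusStructure X} (hS : extDist X ∈ S.M)
    (hcomp : MobiusCompact S) (hpt : IsPtolemyStructure S) (hI : PropertyI S) {ω : X} {c : ℝ → X}
    (hc : IsLine ω c) : IsNice X where
  ptolemy := ptolemyIneq_of_mem hS hpt
  inv := hasInversions_of_propertyI hS hcomp (ptolemyIneq_of_mem hS hpt) hI (hc.1 0).symm
    (hc.1 1).symm
    (hc.injective.ne zero_ne_one)
  line := ⟨ω, c, hc⟩

theorem exists_conf_remote [CompactSpace X] (hX : IsNice X) (ω o : X) :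
    ∃ θ : X → X, IsConf θ ∧ θ ω = o := by
  rcases eq_or_ne o ω with rfl | h
  · exact ⟨_, isConf_id, rfl⟩
  · obtain ⟨φ, hφ⟩ := hX.exists_inv h one_pos
    exact ⟨φ, hφ.conf, hφ.remote⟩

theorem surjective_of_abs_sub {f : ℝ → ℝ} (hf : ∀ t u, |f t - f u| = |t - u|) :
    Function.Surjective f := by
  intro y
  have h1 := hf (y - f 0) 0
  have h2 := hf (-(y - f 0)) 0
  have h3 := hf (y - f 0) (-(y - f 0))
  have key : f (y - f 0) = y ∨ f (-(y - f 0)) = y := by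
    simp only [sub_zero, abs_neg] at h1 h2
    rcases abs_eq_abs.1 h1 with h1 | h1
    · left; linarith
    rcases abs_eq_abs.1 h2 with h2 | h2
    · right; linarith
    · have e : f (y - f 0) = f (-(y - f 0)) := by linarith
      rw [e, sub_self, abs_zero, eq_comm, abs_eq_zero] at h3
      left
      linarith
  rcases key with h | h
  · exact ⟨_, h⟩
  · exact ⟨_, h⟩

theorem exists_auto_of_extDist_mem {S : MobiusStructure X} (hS : extDist X ∈ S.M)
    (hpt : IsPtolemyStructure S) (hcomp : MobiusCompact S) (hI : PropertyI S)
    {σ σ' : Set X} (hσ : IsPtolemyCircle S σ) {ψ : X → X} (hbij : BijOn ψ σ σ')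
    (hcr : ∀ d ∈ S.M, ∀ x ∈ σ, ∀ y ∈ σ, ∀ z ∈ σ, ∀ u ∈ σ, Admissible x y z u →
      ProjEq (crtVec d x y z u) (crtVec d (ψ x) (ψ y) (ψ z) (ψ u))) :
    ∃ φ : X → X, IsMobiusAuto S φ ∧ ∀ x ∈ σ, φ x = ψ x := by
  have : CompactSpace X := compactSpace_of_mobiusCompact hS hcomp
  have hσ₁ := (isPtolemyCircle_iff hS hcomp).1 hσ
  obtain ⟨ω, hω⟩ : σ.Nonempty := by
    obtain ⟨⟨E⟩, -⟩ := hσ₁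
    exact ⟨_, (E.symm ⟨1, by simp⟩).2⟩
  obtain ⟨c, hc, hcσ⟩ := hσ₁.exists_line hω
  have hX := isNice_of_propertyI hS hcomp hpt hI hc
  have hcmem : ∀ t, c t ∈ σ := fun t => (hcσ ▸ mem_range_self t : c t ∈ σ \ {ω}).1
  have hcω : ∀ x ∈ σ, x = ω ∨ ∃ t, c t = x := fun x hx => by
    by_cases h : x = ω
    · exact .inl h
    · exact .inr (hcσ.symm ▸ (⟨hx, h⟩ : x ∈ σ \ {ω}) : x ∈ range c)
  obtain ⟨m, hm, hψ⟩ := exists_factor_of_projEq (i := fun x : σ => (x : X))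
    (j := fun x : σ => ψ x) Subtype.val_injective (injOn_iff_injective.1 hbij.2.1)
    (fun x y z u => hcr _ hS x x.2 y y.2 z z.2 u u.2)
    (a := ⟨ω, hω⟩) (b := ⟨c 0, hcmem 0⟩) (c := ⟨c 1, hcmem 1⟩)
    (fun h => hc.1 0 (congrArg Subtype.val h).symm) (fun h => hc.1 1 (congrArg Subtype.val h).symm)
    (fun h => zero_ne_one (hc.injective (congrArg Subtype.val h)))
  obtain ⟨κ', hκ', hψrd⟩ : ∃ κ' : ℝ, 0 < κ' ∧
      ∀ t u, rd (ψ ω) (ψ (c t)) (ψ (c u)) = κ' * |t - u| := by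
    refine ⟨(m ⟨ω, hω⟩ ^ 2)⁻¹, by have := hm ⟨ω, hω⟩; positivity, fun t u => ?_⟩
    have e1 := hψ ⟨c t, hcmem t⟩ ⟨c u, hcmem u⟩
    have e2 := hψ ⟨c t, hcmem t⟩ ⟨ω, hω⟩
    have e3 := hψ ⟨c u, hcmem u⟩ ⟨ω, hω⟩
    have h1 := (hm ⟨ω, hω⟩).ne'; have h2 := (hm ⟨c t, hcmem t⟩).ne'
    have h3 := (hm ⟨c u, hcmem u⟩).ne'
    simp only at e1 e2 e3
    rw [← hc.2, rd, rd, e1, e2, e3]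
    have h4 := (dist_pos.2 (hc.1 t)).ne'; have h5 := (dist_pos.2 (hc.1 u)).ne'
    field_simp
  set w : ℝ → X := fun t => ψ (c (t / κ')) with hw_def
  have hw : IsLine (ψ ω) w := by
    refine ⟨fun t h => hc.1 _ (hbij.2.1 (hcmem _) hω h), fun t u => ?_⟩
    rw [hw_def, hψrd, ← sub_div, abs_div, abs_of_pos hκ']
    field_simp
  have hwψ : ∀ t, ψ (c t) = w (κ' * t) := fun t => by
    rw [hw_def]
    simp only
    rw [mul_div_cancel_left₀ _ hκ'.ne']
  obtain ⟨θ, hθ, hθω⟩ := exists_conf_remote hX ω (ψ ω)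
  obtain ⟨κ, hκ, hθrd⟩ := hθ.exists_factor ω
  have hc₀ := hc.map hθ hκ hθrd
  rw [hθω] at hc₀
  set c₀ : ℝ → X := fun t => θ (c (t / κ)) with hc₀_def
  have hθc : ∀ t, θ (c t) = c₀ (κ * t) := fun t => by
    rw [hc₀_def]
    simp only
    rw [mul_div_cancel_left₀ _ hκ.ne']
  by_cases hx : ∃ x, x ≠ ψ ω ∧ x ∉ range c₀
  · obtain ⟨x, hx, hxc⟩ := hx
    obtain ⟨g, hg, hgω, hgc⟩ := exists_conf_line hX hc₀ hw hx hxc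
    obtain ⟨h, hh⟩ := hX.exists_hom (hc₀.1 0) (div_pos hκ' hκ)
    refine ⟨_, isMobiusAuto_of_isConf hS (hg.comp (hh.conf.comp hθ)), fun x hx => ?_⟩
    rcases hcω x hx with rfl | ⟨t, rfl⟩
    · rw [hθω, hh.remote, hgω]
    · rw [hθc, hh.line c₀ hc₀ 0 rfl, hgc, hwψ]
      congr 1
      field_simp
      ring
  · push Not at hx
    have hθσ : ∀ x, x ∈ σ := fun x => by
      rcases eq_or_ne (θ x) (ψ ω) with h | h
      · rw [← hθω] at h
        rw [hθ.injective h]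
        exact hω
      · obtain ⟨t, ht⟩ := hx _ h
        rw [← hθ.injective ht]
        exact hcmem _
    refine ⟨ψ, ⟨⟨fun x y h => hbij.2.1 (hθσ x) (hθσ y) h, fun y => ?_⟩, fun d hd x y z u =>
      hcr d hd x (hθσ x) y (hθσ y) z (hθσ z) u (hθσ u)⟩, fun x _ => rfl⟩
    rcases eq_or_ne y (ψ ω) with rfl | h
    · exact ⟨ω, rfl⟩
    choose f hf using fun t => hx (w t) (hw.1 t)
    obtain ⟨s, hs⟩ := hx y h
    obtain ⟨t, ht⟩ := surjective_of_abs_sub (f := f) (fun t u => by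
      rw [← hc₀.2, hf, hf, hw.2]) s
    exact ⟨c (t / κ'), by rw [← hs, ← ht, hf]⟩

end

/-- Proposition 7.1, the extension property (E₂).  Let `X` be a
compact Ptolemy space with properties (E) and (I).  Then every bijection `ψ` between
two Ptolemy circles `σ, σ' ⊆ X` preserving cross-ratio triples extends to a Möbius
automorphism of `X`. -/
theorem stmt_14 {X : Type*} (S : MobiusStructure X)
    (hpt : IsPtolemyStructure S) (hcomp : MobiusCompact S)
    (hE : PropertyE S) (hI : PropertyI S)
    (σ σ' : Set X) (hσ : IsPtolemyCircle S σ) (hσ' : IsPtolemyCircle S σ')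
    (ψ : X → X) (hbij : Set.BijOn ψ σ σ')
    (hcr : ∀ d ∈ S.M, ∀ x ∈ σ, ∀ y ∈ σ, ∀ z ∈ σ, ∀ u ∈ σ, Admissible x y z u →
      ProjEq (crtVec d x y z u) (crtVec d (ψ x) (ψ y) (ψ z) (ψ u))) :
    ∃ φ : X → X, IsMobiusAuto S φ ∧ ∀ x ∈ σ, φ x = ψ x := by
  obtain ⟨d, hd⟩ := S.nonempty
  obtain ⟨a, b, hab⟩ : ∃ a b : X, a ≠ b := by
    let _ : TopologicalSpace X := mobiusTop S
    obtain ⟨⟨E⟩, -⟩ := hσ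
    let p : Metric.sphere (0 : ℂ) 1 := ⟨1, by simp⟩
    let q : Metric.sphere (0 : ℂ) 1 := ⟨-1, by simp⟩
    refine ⟨E.symm p, E.symm q, fun h => ?_⟩
    have h1 : p = q := E.symm.injective (Subtype.ext h)
    have h2 := congrArg (fun x : Metric.sphere (0 : ℂ) 1 => (x : ℂ).re) h1
    norm_num [p, q] at h2
  let _ := boundedMetric hpt hd hab
  exact exists_auto_of_extDist_mem (extDist_boundedMetric_mem hpt hd hab) hpt hcomp hI hσ hbij hcr

end Mobius
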